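/- arXiv:1805.02945 — 2 statements merged into one kernel-verified Lean document; each statement's English description precedes it below -/
import Mathlib

section
/- Let (u_n) be defined by u₀ = 1 and u_{n+1} = u_n(u_n + 1), and let c₀ be the limit of u_n^(2^{-n}) as n → ∞ (this limit exists and c₀ = 1.264…). Then for every ε > 0 there exists K = K(ε) such that for all integers k ≥ K, f_k(1,1) < c₀^( (7/17 + ε) · 2^(k-1) ). -/
/-- `numSols k m n` is the number of nondecreasing `k`-tuples of positive integers
`(a₁, …, a_k)` with `m / n = 1/a₁ + ⋯ + 1/a_k`. -/
noncomputable def numSols (k m n : ℕ) : ℕ :=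
  Nat.card {a : Fin k → ℕ // (∀ i, 0 < a i) ∧ Monotone a ∧
    (m : ℚ) / n = ∑ i, (1 : ℚ) / a i}

/-- The sequence u₀ = 1, u_{n+1} = u_n (u_n + 1). -/
def u : ℕ → ℕ
  | 0 => 1
  | n + 1 => u n * (u n + 1)

/-! ### The divisor bound -/

lemma divisor_local (δ : ℝ) (hδ : 0 < δ) : ∃ C : ℝ, 1 ≤ C ∧ ∀ p e : ℕ, 2 ≤ p →
    ((e : ℝ) + 1) ≤ C * ((p : ℝ) ^ e) ^ δ := by
  have hl : 0 < δ * Real.log 2 := mul_pos hδ (Real.log_pos (by norm_num))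
  refine ⟨1 + 1 / (δ * Real.log 2), by
    have : 0 < 1 / (δ * Real.log 2) := by positivity
    linarith, fun p e hp => ?_⟩
  have hp' : (2 : ℝ) ≤ p := by exact_mod_cast hp
  have h1 : ((2 : ℝ) ^ e) ^ δ ≤ ((p : ℝ) ^ e) ^ δ := by gcongr
  have h2 : 1 + (e : ℝ) * (δ * Real.log 2) ≤ ((2 : ℝ) ^ e) ^ δ := by
    rw [Real.rpow_def_of_pos (by positivity), Real.log_pow]
    have := Real.add_one_le_exp ((e : ℝ) * Real.log 2 * δ)
    linarith
  have h3 : (e : ℝ) + 1 ≤ (1 + 1 / (δ * Real.log 2)) * (1 + (e : ℝ) * (δ * Real.log 2)) := by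
    have : (1 + 1 / (δ * Real.log 2)) * (1 + (e : ℝ) * (δ * Real.log 2))
        = 1 + e + 1 / (δ * Real.log 2) + e * (δ * Real.log 2) := by
      field_simp
      ring
    rw [this]
    have : 0 < 1 / (δ * Real.log 2) := by positivity
    have : 0 ≤ e * (δ * Real.log 2) := by positivity
    linarith
  calc (e : ℝ) + 1 ≤ _ := h3
    _ ≤ _ := by
      have : 0 < 1 / (δ * Real.log 2) := by positivity
      gcongr
      exact h2.trans h1

lemma divisor_bound (δ : ℝ) (hδ : 0 < δ) : ∃ K : ℝ, 1 ≤ K ∧ ∀ n : ℕ, n ≠ 0 →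
    (n.divisors.card : ℝ) ≤ K * (n : ℝ) ^ δ := by
  obtain ⟨C, hC, hloc⟩ := divisor_local δ hδ
  obtain ⟨P, hP⟩ := exists_nat_ge ((2 : ℝ) ^ (1 / δ))
  refine ⟨C ^ P, one_le_pow₀ hC, fun n hn => ?_⟩
  rw [Nat.card_divisors hn]
  push_cast
  have hprod : (n : ℝ) ^ δ = ∏ p ∈ n.primeFactors, (((p : ℝ) ^ (n.factorization p)) ^ δ) := by
    rw [Real.finsetProd_rpow _ _ (fun i _ => by positivity)]
    congr 1
    conv_lhs => rw [← Nat.prod_factorization_pow_eq_self hn]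
    rw [Finsupp.prod]
    push_cast
    rfl
  have hbig : ∀ p e : ℕ, P ≤ p → ((e : ℝ) + 1) ≤ ((p : ℝ) ^ e) ^ δ := by
    intro p e hp
    have hp2 : (2 : ℝ) ≤ (p : ℝ) ^ δ := by
      have h1 : (2 : ℝ) ^ (1 / δ) ≤ p := hP.trans (by exact_mod_cast hp)
      have h2 : ((2 : ℝ) ^ (1 / δ)) ^ δ ≤ (p : ℝ) ^ δ := by gcongr
      rwa [← Real.rpow_mul (by norm_num), one_div_mul_cancel hδ.ne', Real.rpow_one] at h2
    rw [← Real.rpow_natCast, ← Real.rpow_mul (by positivity), mul_comm (e : ℝ),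
      Real.rpow_mul (by positivity), Real.rpow_natCast]
    have h3 : (2 : ℝ) ^ e ≤ ((p : ℝ) ^ δ) ^ e := by gcongr
    have h4 : (e : ℝ) + 1 ≤ 2 ^ e := by exact_mod_cast Nat.lt_two_pow_self (n := e)
    exact h4.trans h3
  have hmain : ∏ p ∈ n.primeFactors, ((n.factorization p : ℝ) + 1) ≤
      ∏ p ∈ n.primeFactors, ((if p < P then C else 1) *
        (((p : ℝ) ^ (n.factorization p)) ^ δ)) := by
    refine Finset.prod_le_prod (fun i _ => by positivity) (fun p hp => ?_)
    split_ifs with h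
    · exact hloc p _ (Nat.prime_of_mem_primeFactors hp).two_le
    · rw [one_mul]
      exact hbig p _ (not_lt.mp h)
  refine hmain.trans ?_
  rw [Finset.prod_mul_distrib, ← hprod]
  gcongr
  rw [Finset.prod_ite, Finset.prod_const, Finset.prod_const_one, mul_one]
  refine pow_le_pow_right₀ hC ?_
  calc _ ≤ (Finset.range P).card := Finset.card_le_card (by
        intro p hp
        simp only [Finset.mem_filter] at hp
        exact Finset.mem_range.mpr hp.2)
    _ = P := Finset.card_range P

/-! ### Encoding a divisor by its rank -/

def encDiv (N d : ℕ) : ℕ := (N.divisors.filter (· < d)).card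

lemma encDiv_lt {N d : ℕ} (hN : N ≠ 0) (h : d ∣ N) : encDiv N d < N.divisors.card := by
  unfold encDiv
  apply Finset.card_lt_card
  rw [Finset.filter_ssubset]
  exact ⟨d, Nat.mem_divisors.mpr ⟨h, hN⟩, lt_irrefl d⟩

lemma encDiv_lt_of {N d d' : ℕ} (hN : N ≠ 0) (h : d ∣ N) (hlt : d < d') :
    encDiv N d < encDiv N d' := by
  unfold encDiv
  apply Finset.card_lt_card
  rw [Finset.ssubset_iff_of_subset]
  · exact ⟨d, by simp [h, hN, hlt], by simp⟩
  · intro x hx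
    simp only [Finset.mem_filter] at hx ⊢
    exact ⟨hx.1, hx.2.trans hlt⟩

lemma encDiv_inj {N d d' : ℕ} (hN : N ≠ 0) (h : d ∣ N) (h' : d' ∣ N)
    (heq : encDiv N d = encDiv N d') : d = d' := by
  rcases lt_trichotomy d d' with hlt | hlt | hlt
  · exact absurd heq (encDiv_lt_of hN h hlt).ne
  · exact hlt
  · exact absurd heq.symm (encDiv_lt_of hN h' hlt).ne

/-! ### Parametrisation of sums of three unit fractions -/

structure Par where
  (n1 n2 n3 N1 N2 N3 A B D E v w : ℕ)

structure Par.Good (p : Par) (m n a b c : ℕ) : Prop where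
  hn1 : p.n1 * p.N1 = n
  hn2 : p.n2 * p.N2 = n
  hn3 : p.n3 * p.N3 = n
  ha : a = p.n1 * (p.A * p.B * p.D)
  hb : b = p.n2 * (p.A * p.E * p.D)
  hc : c = p.n3 * (p.B * p.E * p.D)
  hA : 0 < p.A
  hB : 0 < p.B
  hD : 0 < p.D
  hE : 0 < p.E
  heq : m * p.A * p.B * p.D * p.E = p.N1 * p.E + p.N2 * p.B + p.N3 * p.A
  hv : p.E * p.v = p.N2 * p.B + p.N3 * p.A
  hv' : p.v + p.N1 = m * p.A * p.B * p.D
  hw : p.A * (Nat.gcd p.N1 p.N2 * p.w) = p.N1 * p.E + p.N2 * p.B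
  hw' : Nat.gcd p.N1 p.N2 * p.w + p.N3 = m * p.B * p.E * p.D

lemma split_coprime {m D N x y z R : ℕ}
    (h3 : Nat.gcd (Nat.gcd x y) z = 1) (hcop : Nat.Coprime x N)
    (h : m * D * x * y * z = N * (y * z) + x * R) :
    x = Nat.gcd x y * Nat.gcd x z := by
  have h1 : x ∣ N * (y * z) := by
    have : x ∣ N * (y * z) + x * R := by rw [← h]; exact ⟨m * D * y * z, by ring⟩
    exact (Nat.dvd_add_left (dvd_mul_right _ _)).mp this
  have h2 : x ∣ y * z := hcop.dvd_of_dvd_mul_left h1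
  apply Nat.dvd_antisymm
  · have h4 := Nat.gcd_mul_right_dvd_mul_gcd x y z
    rwa [Nat.gcd_eq_left h2] at h4
  · apply Nat.Coprime.mul_dvd_of_dvd_of_dvd _ (Nat.gcd_dvd_left _ _) (Nat.gcd_dvd_left _ _)
    have : Nat.gcd (Nat.gcd x y) (Nat.gcd x z) ∣ Nat.gcd (Nat.gcd x y) z :=
      Nat.dvd_gcd (Nat.gcd_dvd_left _ _) ((Nat.gcd_dvd_right _ _).trans (Nat.gcd_dvd_right _ _))
    rw [h3] at this
    exact Nat.dvd_one.mp this

lemma exists_par {m n a b c : ℕ} (ha : 0 < a) (hb : 0 < b) (hc : 0 < c)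
    (h : m * a * b * c = n * (b * c + a * c + a * b)) : ∃ p : Par, p.Good m n a b c := by
  obtain ⟨n1, t1, N1, hn1, hcop1, ea, en1⟩ : ∃ n1 t1 N1, 0 < n1 ∧ Nat.Coprime t1 N1 ∧
      a = t1 * n1 ∧ n = N1 * n1 := by
    obtain ⟨t, N, h1, h2, h3⟩ := Nat.exists_coprime a n
    exact ⟨_, t, N, Nat.gcd_pos_of_pos_left _ ha, h1, h2, h3⟩
  obtain ⟨n2, t2, N2, hn2, hcop2, eb, en2⟩ : ∃ n1 t1 N1, 0 < n1 ∧ Nat.Coprime t1 N1 ∧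
      b = t1 * n1 ∧ n = N1 * n1 := by
    obtain ⟨t, N, h1, h2, h3⟩ := Nat.exists_coprime b n
    exact ⟨_, t, N, Nat.gcd_pos_of_pos_left _ hb, h1, h2, h3⟩
  obtain ⟨n3, t3, N3, hn3, hcop3, ec, en3⟩ : ∃ n1 t1 N1, 0 < n1 ∧ Nat.Coprime t1 N1 ∧
      c = t1 * n1 ∧ n = N1 * n1 := by
    obtain ⟨t, N, h1, h2, h3⟩ := Nat.exists_coprime c n
    exact ⟨_, t, N, Nat.gcd_pos_of_pos_left _ hc, h1, h2, h3⟩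
  have ht1 : 0 < t1 := Nat.pos_of_ne_zero (by rintro rfl; simp at ea; omega)
  have ht2 : 0 < t2 := Nat.pos_of_ne_zero (by rintro rfl; simp at eb; omega)
  have ht3 : 0 < t3 := Nat.pos_of_ne_zero (by rintro rfl; simp at ec; omega)
  -- the equation in terms of the `t`s
  have heq : m * t1 * t2 * t3 = N1 * (t2 * t3) + N2 * (t1 * t3) + N3 * (t1 * t2) := by
    have hpos : 0 < n1 * n2 * n3 := by positivity
    apply Nat.eq_of_mul_eq_mul_left hpos
    calc n1 * n2 * n3 * (m * t1 * t2 * t3) = m * a * b * c := by rw [ea, eb, ec]; ring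
      _ = n * (b * c) + n * (a * c) + n * (a * b) := by rw [h]; ring
      _ = (N1 * n1) * (b * c) + (N2 * n2) * (a * c) + (N3 * n3) * (a * b) := by
        rw [← en1, ← en2, ← en3]
      _ = _ := by rw [ea, eb, ec]; ring
  -- common factor
  obtain ⟨D, hD, s1, s2, s3, e1, e2, e3, h3⟩ : ∃ D, 0 < D ∧ ∃ s1 s2 s3, t1 = D * s1 ∧
      t2 = D * s2 ∧ t3 = D * s3 ∧ Nat.gcd (Nat.gcd s1 s2) s3 = 1 := by
    set D := Nat.gcd (Nat.gcd t1 t2) t3 with hDdef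
    have hD : 0 < D := Nat.gcd_pos_of_pos_right _ ht3
    obtain ⟨s1, e1⟩ : D ∣ t1 := (Nat.gcd_dvd_left _ _).trans (Nat.gcd_dvd_left _ _)
    obtain ⟨s2, e2⟩ : D ∣ t2 := (Nat.gcd_dvd_left _ _).trans (Nat.gcd_dvd_right _ _)
    obtain ⟨s3, e3⟩ : D ∣ t3 := Nat.gcd_dvd_right _ _
    refine ⟨D, hD, s1, s2, s3, e1, e2, e3, ?_⟩
    have : D = D * Nat.gcd (Nat.gcd s1 s2) s3 := by
      rw [← Nat.gcd_mul_left, ← Nat.gcd_mul_left, ← e1, ← e2, ← e3]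
    exact (Nat.eq_of_mul_eq_mul_left hD (by rw [← this, mul_one])).symm
  have hs1 : 0 < s1 := Nat.pos_of_ne_zero (by rintro rfl; simp at e1; omega)
  have hs2 : 0 < s2 := Nat.pos_of_ne_zero (by rintro rfl; simp at e2; omega)
  have hs3 : 0 < s3 := Nat.pos_of_ne_zero (by rintro rfl; simp at e3; omega)
  have heqs : m * D * s1 * s2 * s3 = N1 * (s2 * s3) + N2 * (s1 * s3) + N3 * (s1 * s2) := by
    have hpos : 0 < D * D := by positivity
    apply Nat.eq_of_mul_eq_mul_left hpos
    calc D * D * (m * D * s1 * s2 * s3) = m * t1 * t2 * t3 := by rw [e1, e2, e3]; ring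
      _ = _ := by rw [heq, e1, e2, e3]; ring
  have c1 : Nat.Coprime s1 N1 := hcop1.coprime_dvd_left ⟨D, by rw [e1]; ring⟩
  have c2 : Nat.Coprime s2 N2 := hcop2.coprime_dvd_left ⟨D, by rw [e2]; ring⟩
  have c3 : Nat.Coprime s3 N3 := hcop3.coprime_dvd_left ⟨D, by rw [e3]; ring⟩
  have f1 : s1 = Nat.gcd s1 s2 * Nat.gcd s1 s3 :=
    split_coprime (m := m) (D := D) (R := N2 * s3 + N3 * s2) h3 c1 (by rw [heqs]; ring)
  have f2 : s2 = Nat.gcd s2 s1 * Nat.gcd s2 s3 :=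
    split_coprime (m := m) (D := D) (R := N1 * s3 + N3 * s1)
      (by rw [Nat.gcd_comm s2 s1]; exact h3) c2 (by
        rw [show m * D * s2 * s1 * s3 = m * D * s1 * s2 * s3 by ring, heqs]; ring)
  have f3 : s3 = Nat.gcd s3 s1 * Nat.gcd s3 s2 :=
    split_coprime (m := m) (D := D) (R := N1 * s2 + N2 * s1)
      (by rw [Nat.gcd_assoc, Nat.gcd_comm]; exact h3) c3 (by
        rw [show m * D * s3 * s1 * s2 = m * D * s1 * s2 * s3 by ring, heqs]; ring)
  rw [Nat.gcd_comm s2 s1] at f2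
  rw [Nat.gcd_comm s3 s1, Nat.gcd_comm s3 s2] at f3
  have hA : 0 < Nat.gcd s1 s2 := Nat.gcd_pos_of_pos_left _ hs1
  have hB : 0 < Nat.gcd s1 s3 := Nat.gcd_pos_of_pos_left _ hs1
  have hE : 0 < Nat.gcd s2 s3 := Nat.gcd_pos_of_pos_left _ hs2
  have cA : Nat.Coprime (Nat.gcd s1 s2) N1 := c1.coprime_dvd_left (Nat.gcd_dvd_left _ _)
  generalize Nat.gcd s1 s2 = A at *
  generalize Nat.gcd s1 s3 = B at *
  generalize Nat.gcd s2 s3 = E at *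
  clear h3
  have hE4 : m * A * B * D * E = N1 * E + N2 * B + N3 * A := by
    have hpos : 0 < A * B * E := by positivity
    apply Nat.eq_of_mul_eq_mul_left hpos
    calc A * B * E * (m * A * B * D * E) = m * D * s1 * s2 * s3 := by rw [f1, f2, f3]; ring
      _ = _ := by rw [heqs, f1, f2, f3]; ring
  obtain ⟨v, hv⟩ : E ∣ N2 * B + N3 * A := by
    have : E ∣ N1 * E + (N2 * B + N3 * A) := ⟨m * A * B * D, by rw [← add_assoc, ← hE4]; ring⟩
    exact (Nat.dvd_add_right (dvd_mul_left _ _)).mp this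
  obtain ⟨w0, hw0⟩ : A ∣ N1 * E + N2 * B := by
    have : A ∣ (N1 * E + N2 * B) + N3 * A := ⟨m * B * D * E, by rw [← hE4]; ring⟩
    exact (Nat.dvd_add_left (dvd_mul_left _ _)).mp this
  obtain ⟨w, hw⟩ : Nat.gcd N1 N2 ∣ w0 := by
    have hg : Nat.Coprime (Nat.gcd N1 N2) A :=
      (cA.symm).coprime_dvd_left (Nat.gcd_dvd_left _ _)
    apply hg.dvd_of_dvd_mul_left
    rw [← hw0]
    exact dvd_add ((Nat.gcd_dvd_left _ _).mul_right _) ((Nat.gcd_dvd_right _ _).mul_right _)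
  refine ⟨⟨n1, n2, n3, N1, N2, N3, A, B, D, E, v, w⟩, ?_⟩
  constructor <;> dsimp only
  · rw [en1]; ring
  · rw [en2]; ring
  · rw [en3]; ring
  · rw [ea, e1, f1]; ring
  · rw [eb, e2, f2]; ring
  · rw [ec, e3, f3]; ring
  · exact hA
  · exact hB
  · exact hD
  · exact hE
  · exact hE4
  · exact hv.symm
  · apply Nat.eq_of_mul_eq_mul_left hE
    calc E * (v + N1) = N1 * E + (N2 * B + N3 * A) := by rw [hv]; ring
      _ = _ := by rw [← add_assoc, ← hE4]; ring
  · rw [← hw]; exact hw0.symm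
  · rw [← hw]
    apply Nat.eq_of_mul_eq_mul_left hA
    calc A * (w0 + N3) = N1 * E + N2 * B + N3 * A := by rw [hw0]; ring
      _ = _ := by rw [← hE4]; ring

/-! ### Counting sums of three unit fractions -/

structure IsSol (m n a b c : ℕ) : Prop where
  ha : 0 < a
  hab : a ≤ b
  hbc : b ≤ c
  h : m * a * b * c = n * (b * c + a * c + a * b)

namespace Par.Good

variable {p : Par} {m n a b c : ℕ}

lemma n1_pos (h : p.Good m n a b c) (hn : 0 < n) : 0 < p.n1 :=
  Nat.pos_of_mul_pos_right (h.hn1 ▸ hn)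
lemma n2_pos (h : p.Good m n a b c) (hn : 0 < n) : 0 < p.n2 :=
  Nat.pos_of_mul_pos_right (h.hn2 ▸ hn)
lemma n3_pos (h : p.Good m n a b c) (hn : 0 < n) : 0 < p.n3 :=
  Nat.pos_of_mul_pos_right (h.hn3 ▸ hn)
lemma N1_pos (h : p.Good m n a b c) (hn : 0 < n) : 0 < p.N1 :=
  Nat.pos_of_mul_pos_left (h.hn1 ▸ hn)
lemma N2_pos (h : p.Good m n a b c) (hn : 0 < n) : 0 < p.N2 :=
  Nat.pos_of_mul_pos_left (h.hn2 ▸ hn)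
lemma N3_pos (h : p.Good m n a b c) (hn : 0 < n) : 0 < p.N3 :=
  Nat.pos_of_mul_pos_left (h.hn3 ▸ hn)
lemma N1_le (h : p.Good m n a b c) (hn : 0 < n) : p.N1 ≤ n :=
  Nat.le_of_dvd hn ⟨p.n1, by rw [← h.hn1]; ring⟩
lemma N2_le (h : p.Good m n a b c) (hn : 0 < n) : p.N2 ≤ n :=
  Nat.le_of_dvd hn ⟨p.n2, by rw [← h.hn2]; ring⟩
lemma N3_le (h : p.Good m n a b c) (hn : 0 < n) : p.N3 ≤ n :=
  Nat.le_of_dvd hn ⟨p.n3, by rw [← h.hn3]; ring⟩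

lemma v_pos (h : p.Good m n a b c) (hn : 0 < n) : 0 < p.v := by
  have h1 : 0 < p.E * p.v := by
    rw [h.hv]
    have := Nat.mul_pos (h.N2_pos hn) h.hB
    omega
  exact Nat.pos_of_mul_pos_left h1

lemma gw_pos (h : p.Good m n a b c) (hn : 0 < n) : 0 < Nat.gcd p.N1 p.N2 * p.w := by
  have h1 : 0 < p.A * (Nat.gcd p.N1 p.N2 * p.w) := by
    rw [h.hw]
    have := Nat.mul_pos (h.N2_pos hn) h.hB
    omega
  exact Nat.pos_of_mul_pos_left h1

lemma mABD_le (h : p.Good m n a b c) (hn : 0 < n) (hs : IsSol m n a b c) :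
    m * p.A * p.B * p.D ≤ 3 * n := by
  have hb : 0 < b := hs.ha.trans_le hs.hab
  have hc : 0 < c := hb.trans_le hs.hbc
  have h1 : m * a ≤ 3 * n := by
    have hbc : 0 < b * c := Nat.mul_pos hb hc
    apply Nat.le_of_mul_le_mul_right _ hbc
    calc m * a * (b * c) = n * (b * c + a * c + a * b) := by rw [← hs.h]; ring
      _ ≤ n * (b * c + b * c + c * b) := by
        have := hs.hab
        have := hs.hab.trans hs.hbc
        gcongr
      _ = _ := by ring
  have h2 : m * p.A * p.B * p.D ≤ m * a := by
    rw [h.ha]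
    calc m * p.A * p.B * p.D = 1 * (m * (p.A * p.B * p.D)) := by ring
      _ ≤ p.n1 * (m * (p.A * p.B * p.D)) := Nat.mul_le_mul_right _ (h.n1_pos hn)
      _ = _ := by ring
  exact h2.trans h1

lemma ABD_le (h : p.Good m n a b c) (hm : 0 < m) (hn : 0 < n) (hs : IsSol m n a b c) :
    p.A * p.B * p.D ≤ 3 * n := by
  refine le_trans ?_ (h.mABD_le hn hs)
  calc p.A * p.B * p.D = 1 * (p.A * p.B * p.D) := by ring
    _ ≤ m * (p.A * p.B * p.D) := Nat.mul_le_mul_right _ hm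
    _ = _ := by ring

lemma N3A_le (h : p.Good m n a b c) (hn : 0 < n) (hs : IsSol m n a b c) :
    p.N3 * p.A ≤ p.N2 * p.B := by
  have h1 : p.n2 * p.A ≤ p.n3 * p.B := by
    apply Nat.le_of_mul_le_mul_right _ (Nat.mul_pos h.hE h.hD)
    calc p.n2 * p.A * (p.E * p.D) = b := by rw [h.hb]; ring
      _ ≤ c := hs.hbc
      _ = _ := by rw [h.hc]; ring
  apply Nat.le_of_mul_le_mul_left _ (Nat.mul_pos (h.n2_pos hn) (h.n3_pos hn))
  calc p.n2 * p.n3 * (p.N3 * p.A) = (p.n3 * p.N3) * (p.n2 * p.A) := by ring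
    _ = n * (p.n2 * p.A) := by rw [h.hn3]
    _ ≤ n * (p.n3 * p.B) := Nat.mul_le_mul_left _ h1
    _ = (p.n2 * p.N2) * (p.n3 * p.B) := by rw [h.hn2]
    _ = _ := by ring

lemma N2B_le (h : p.Good m n a b c) (hn : 0 < n) (hs : IsSol m n a b c) :
    p.N2 * p.B ≤ p.N1 * p.E := by
  have h1 : p.n1 * p.B ≤ p.n2 * p.E := by
    apply Nat.le_of_mul_le_mul_right _ (Nat.mul_pos h.hA h.hD)
    calc p.n1 * p.B * (p.A * p.D) = a := by rw [h.ha]; ring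
      _ ≤ b := hs.hab
      _ = _ := by rw [h.hb]; ring
  apply Nat.le_of_mul_le_mul_left _ (Nat.mul_pos (h.n1_pos hn) (h.n2_pos hn))
  calc p.n1 * p.n2 * (p.N2 * p.B) = (p.n2 * p.N2) * (p.n1 * p.B) := by ring
    _ = n * (p.n1 * p.B) := by rw [h.hn2]
    _ ≤ n * (p.n2 * p.E) := Nat.mul_le_mul_left _ h1
    _ = (p.n1 * p.N1) * (p.n2 * p.E) := by rw [h.hn1]
    _ = _ := by ring

lemma vwA_le (h : p.Good m n a b c) (hn : 0 < n) (hs : IsSol m n a b c) :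
    p.v * p.w * p.A ≤ 4 * n * p.B := by
  have hg : 0 < Nat.gcd p.N1 p.N2 := Nat.gcd_pos_of_pos_left _ (h.N1_pos hn)
  have hl : Nat.lcm p.N1 p.N2 ≤ n := Nat.le_of_dvd hn
    (Nat.lcm_dvd ⟨p.n1, by rw [← h.hn1]; ring⟩ ⟨p.n2, by rw [← h.hn2]; ring⟩)
  apply Nat.le_of_mul_le_mul_left _ (Nat.mul_pos hg h.hE)
  calc Nat.gcd p.N1 p.N2 * p.E * (p.v * p.w * p.A)
      = (p.E * p.v) * (p.A * (Nat.gcd p.N1 p.N2 * p.w)) := by ring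
    _ = (p.N2 * p.B + p.N3 * p.A) * (p.N1 * p.E + p.N2 * p.B) := by rw [h.hv, h.hw]
    _ ≤ (p.N2 * p.B + p.N2 * p.B) * (p.N1 * p.E + p.N1 * p.E) := by
      have := h.N3A_le hn hs
      have := h.N2B_le hn hs
      gcongr
    _ = 4 * (p.N1 * p.N2) * (p.B * p.E) := by ring
    _ = 4 * (Nat.gcd p.N1 p.N2 * Nat.lcm p.N1 p.N2) * (p.B * p.E) := by rw [Nat.gcd_mul_lcm]
    _ ≤ 4 * (Nat.gcd p.N1 p.N2 * n) * (p.B * p.E) := by gcongr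
    _ = _ := by ring

lemma five_cases (h : p.Good m n a b c) (hm : 0 < m) (hn : 0 < n) (hs : IsSol m n a b c)
    {X : ℕ} (hX : 36 * n ^ 3 ≤ X ^ 5) :
    p.A * p.B ≤ X ∨ p.A * p.D ≤ X ∨ p.B * p.D ≤ X ∨ p.v ≤ X ∨ p.w ≤ X := by
  by_contra! hcon
  obtain ⟨h1, h2, -, h4, h5⟩ := hcon
  have hX0 : 0 < X := Nat.pos_of_ne_zero (by
    rintro rfl
    have : 0 < n ^ 3 := by positivity
    simp at hX
    omega)
  have k1 : X * X ≤ p.A * (3 * n) := by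
    calc X * X ≤ (p.A * p.B) * (p.A * p.D) := Nat.mul_le_mul h1.le h2.le
      _ = p.A * (p.A * p.B * p.D) := by ring
      _ ≤ _ := Nat.mul_le_mul_left _ (h.ABD_le hm hn hs)
  have k2 : p.B * X ≤ 3 * n := by
    calc p.B * X ≤ p.B * (p.A * p.D) := Nat.mul_le_mul_left _ h2.le
      _ = p.A * p.B * p.D := by ring
      _ ≤ _ := h.ABD_le hm hn hs
  have k3 : X * X * p.A < 4 * n * p.B := by
    calc X * X * p.A < p.v * p.w * p.A :=
          Nat.mul_lt_mul_of_pos_right (Nat.mul_lt_mul'' h4 h5) h.hA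
      _ ≤ _ := h.vwA_le hn hs
  have : X ^ 5 < 36 * n ^ 3 := by
    calc X ^ 5 = (X * X) * X * (X * X) := by ring
      _ ≤ (X * X) * X * (p.A * (3 * n)) := Nat.mul_le_mul_left _ k1
      _ = (X * X * p.A) * (3 * n * X) := by ring
      _ < (4 * n * p.B) * (3 * n * X) := Nat.mul_lt_mul_of_pos_right k3 (by positivity)
      _ = 12 * n ^ 2 * (p.B * X) := by ring
      _ ≤ 12 * n ^ 2 * (3 * n) := Nat.mul_le_mul_left _ k2
      _ = _ := by ring
  omega

lemma A_le (h : p.Good m n a b c) (hm : 0 < m) (hn : 0 < n) (hs : IsSol m n a b c) :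
    p.A ≤ 3 * n := le_trans (Nat.le_of_dvd
      (Nat.mul_pos (Nat.mul_pos h.hA h.hB) h.hD) ⟨p.B * p.D, by ring⟩) (h.ABD_le hm hn hs)

lemma B_le (h : p.Good m n a b c) (hm : 0 < m) (hn : 0 < n) (hs : IsSol m n a b c) :
    p.B ≤ 3 * n := le_trans (Nat.le_of_dvd
      (Nat.mul_pos (Nat.mul_pos h.hA h.hB) h.hD) ⟨p.A * p.D, by ring⟩) (h.ABD_le hm hn hs)

lemma v_dvd1 (h : p.Good m n a b c) :
    p.v ∣ p.N1 * p.N2 + m * (p.A * p.D) * p.N3 * p.A := by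
  have key : m * (p.A * p.D) * p.B * (p.E * p.v) =
      p.v * p.N2 * p.B + p.B * (p.N1 * p.N2 + m * (p.A * p.D) * p.N3 * p.A) := by
    calc _ = (m * p.A * p.B * p.D) * (p.N2 * p.B + p.N3 * p.A) := by rw [h.hv]; ring
      _ = (m * p.A * p.B * p.D) * (p.N2 * p.B) + p.B * (m * (p.A * p.D) * p.N3 * p.A) := by ring
      _ = _ := by rw [← h.hv']; ring
  have h2 : p.B * (p.v * p.N2 + (p.N1 * p.N2 + m * (p.A * p.D) * p.N3 * p.A)) =
      p.B * (p.v * (m * (p.A * p.D) * p.E)) := by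
    rw [mul_add]
    calc _ = p.v * p.N2 * p.B + p.B * (p.N1 * p.N2 + m * (p.A * p.D) * p.N3 * p.A) := by ring
      _ = _ := by rw [← key]; ring
  have h3 := Nat.eq_of_mul_eq_mul_left h.hB h2
  exact (Nat.dvd_add_right (dvd_mul_right _ _)).mp (h3 ▸ dvd_mul_right _ _)

lemma v_dvd2 (h : p.Good m n a b c) :
    p.v ∣ p.N1 * p.N3 + m * (p.B * p.D) * p.N2 * p.B := by
  have key : m * (p.B * p.D) * p.A * (p.E * p.v) =
      p.v * p.N3 * p.A + p.A * (p.N1 * p.N3 + m * (p.B * p.D) * p.N2 * p.B) := by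
    calc _ = (m * p.A * p.B * p.D) * (p.N2 * p.B + p.N3 * p.A) := by rw [h.hv]; ring
      _ = (m * p.A * p.B * p.D) * (p.N3 * p.A) + p.A * (m * (p.B * p.D) * p.N2 * p.B) := by ring
      _ = _ := by rw [← h.hv']; ring
  have h2 : p.A * (p.v * p.N3 + (p.N1 * p.N3 + m * (p.B * p.D) * p.N2 * p.B)) =
      p.A * (p.v * (m * (p.B * p.D) * p.E)) := by
    rw [mul_add]
    calc _ = p.v * p.N3 * p.A + p.A * (p.N1 * p.N3 + m * (p.B * p.D) * p.N2 * p.B) := by ring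
      _ = _ := by rw [← key]; ring
  have h3 := Nat.eq_of_mul_eq_mul_left h.hA h2
  exact (Nat.dvd_add_right (dvd_mul_right _ _)).mp (h3 ▸ dvd_mul_right _ _)

end Par.Good

lemma card_le_of_code {α : Type*} (s : Finset α) (T X : ℕ) (q f1 f2 f3 f4 f5 : α → ℕ)
    (hq : ∀ x ∈ s, q x ≤ X) (h1 : ∀ x ∈ s, f1 x < T) (h2 : ∀ x ∈ s, f2 x < T)
    (h3 : ∀ x ∈ s, f3 x < T) (h4 : ∀ x ∈ s, f4 x < T) (h5 : ∀ x ∈ s, f5 x < T)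
    (hinj : ∀ x ∈ s, ∀ y ∈ s, f1 x = f1 y → f2 x = f2 y → f3 x = f3 y → q x = q y →
      f4 x = f4 y → f5 x = f5 y → x = y) : s.card ≤ (X + 1) * T ^ 5 := by
  let F : α → ℕ × ℕ × ℕ × ℕ × ℕ × ℕ := fun x => (q x, f1 x, f2 x, f3 x, f4 x, f5 x)
  have hc := Finset.card_le_card_of_injOn (s := s)
    (t := Finset.range (X + 1) ×ˢ Finset.range T ×ˢ Finset.range T ×ˢ Finset.range T ×ˢ
      Finset.range T ×ˢ Finset.range T) F
    (by
      intro x hx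
      have hx' : x ∈ s := hx
      simp only [F, Finset.coe_product, Set.mem_prod, Finset.mem_coe, Finset.mem_range]
      exact ⟨Nat.lt_succ_of_le (hq x hx'), h1 x hx', h2 x hx', h3 x hx', h4 x hx', h5 x hx'⟩)
    (by
      intro x hx y hy hxy
      simp only [F, Prod.mk.injEq] at hxy
      obtain ⟨a0, a1, a2, a3, a4, a5⟩ := hxy
      exact hinj x hx y hy a1 a2 a3 a0 a4 a5)
  simp only [Finset.card_product, Finset.card_range] at hc
  calc s.card ≤ _ := hc
    _ = _ := by ring

lemma eq_of_par {m n : ℕ} {p q : Par} {x y : ℕ × ℕ × ℕ}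
    (hp : p.Good m n x.1 x.2.1 x.2.2) (hq : q.Good m n y.1 y.2.1 y.2.2)
    (h1 : p.n1 = q.n1) (h2 : p.n2 = q.n2) (h3 : p.n3 = q.n3)
    (hA : p.A = q.A) (hB : p.B = q.B) (hD : p.D = q.D) (hE : p.E = q.E) : x = y := by
  refine Prod.ext ?_ (Prod.ext ?_ ?_)
  · rw [hp.ha, hq.ha, h1, hA, hB, hD]
  · rw [hp.hb, hq.hb, h2, hA, hE, hD]
  · rw [hp.hc, hq.hc, h3, hB, hE, hD]

lemma cancel_left {a b x y : ℕ} (ha : 0 < a) (hab : a = b) (h : a * x = b * y) : x = y := by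
  subst hab
  exact Nat.eq_of_mul_eq_mul_left ha h

lemma count_three {m n T X : ℕ} (hm : 0 < m) (hn : 0 < n) (hX : 36 * n ^ 3 ≤ X ^ 5)
    (hXn : X ≤ 4 * n) (hT : ∀ y, y ≤ 10 * n ^ 3 → y.divisors.card ≤ T)
    (s : Finset (ℕ × ℕ × ℕ)) (hs : ∀ x ∈ s, IsSol m n x.1 x.2.1 x.2.2) :
    s.card ≤ 5 * ((X + 1) * T ^ 5) := by
  classical
  have hex : ∀ x : ℕ × ℕ × ℕ, ∃ p : Par, x ∈ s → p.Good m n x.1 x.2.1 x.2.2 := by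
    intro x
    by_cases hx : x ∈ s
    · have h := hs x hx
      obtain ⟨p, hp⟩ := exists_par h.ha (h.ha.trans_le h.hab)
        ((h.ha.trans_le h.hab).trans_le h.hbc) h.h
      exact ⟨p, fun _ => hp⟩
    · exact ⟨⟨0, 0, 0, 0, 0, 0, 0, 0, 0, 0, 0, 0⟩, fun h => absurd h hx⟩
  choose P hP using hex
  have hn3 : n ≤ n ^ 3 := Nat.le_self_pow (by norm_num) n
  have hn23 : n * n ≤ n ^ 3 := by
    calc n * n = n ^ 2 := by ring
      _ ≤ n ^ 3 := Nat.pow_le_pow_right hn (by norm_num)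
  -- basic facts
  have encT : ∀ {N d : ℕ}, 0 < N → N ≤ 10 * n ^ 3 → d ∣ N → encDiv N d < T :=
    fun h0 h1 h2 => (encDiv_lt h0.ne' h2).trans_le (hT _ h1)
  have d1 : ∀ x ∈ s, (P x).n1 ∣ n := fun x hx => ⟨_, (hP x hx).hn1.symm⟩
  have d2 : ∀ x ∈ s, (P x).n2 ∣ n := fun x hx => ⟨_, (hP x hx).hn2.symm⟩
  have d3 : ∀ x ∈ s, (P x).n3 ∣ n := fun x hx => ⟨_, (hP x hx).hn3.symm⟩
  have b1 : ∀ x ∈ s, encDiv n (P x).n1 < T := fun x hx => encT hn (by omega) (d1 x hx)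
  have b2 : ∀ x ∈ s, encDiv n (P x).n2 < T := fun x hx => encT hn (by omega) (d2 x hx)
  have b3 : ∀ x ∈ s, encDiv n (P x).n3 < T := fun x hx => encT hn (by omega) (d3 x hx)
  have base : ∀ x ∈ s, ∀ y ∈ s, encDiv n (P x).n1 = encDiv n (P y).n1 →
      encDiv n (P x).n2 = encDiv n (P y).n2 → encDiv n (P x).n3 = encDiv n (P y).n3 →
      ((P x).n1 = (P y).n1 ∧ (P x).n2 = (P y).n2 ∧ (P x).n3 = (P y).n3) ∧
      (P x).N1 = (P y).N1 ∧ (P x).N2 = (P y).N2 ∧ (P x).N3 = (P y).N3 := by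
    intro x hx y hy h1 h2 h3
    have e1 := encDiv_inj hn.ne' (d1 x hx) (d1 y hy) h1
    have e2 := encDiv_inj hn.ne' (d2 x hx) (d2 y hy) h2
    have e3 := encDiv_inj hn.ne' (d3 x hx) (d3 y hy) h3
    have gx := hP x hx
    have gy := hP y hy
    exact ⟨⟨e1, e2, e3⟩, cancel_left (gx.n1_pos hn) e1 (gx.hn1.trans gy.hn1.symm),
      cancel_left (gx.n2_pos hn) e2 (gx.hn2.trans gy.hn2.symm),
      cancel_left (gx.n3_pos hn) e3 (gx.hn3.trans gy.hn3.symm)⟩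
  -- case 1
  have c1 : (s.filter (fun x => (P x).A * (P x).B ≤ X)).card ≤ (X + 1) * T ^ 5 := by
    refine card_le_of_code _ T X (fun x => (P x).A * (P x).B) (fun x => encDiv n (P x).n1)
      (fun x => encDiv n (P x).n2) (fun x => encDiv n (P x).n3)
      (fun x => encDiv ((P x).A * (P x).B) (P x).A)
      (fun x => encDiv ((P x).N2 * (P x).B + (P x).N3 * (P x).A) (P x).E)
      (fun x hx => (Finset.mem_filter.mp hx).2)
      (fun x hx => b1 x (Finset.mem_filter.mp hx).1)
      (fun x hx => b2 x (Finset.mem_filter.mp hx).1)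
      (fun x hx => b3 x (Finset.mem_filter.mp hx).1) ?_ ?_ ?_
    · intro x hx
      obtain ⟨hx, hxX⟩ := Finset.mem_filter.mp hx
      exact encT (Nat.mul_pos (hP x hx).hA (hP x hx).hB) (by omega) (dvd_mul_right _ _)
    · intro x hx
      obtain ⟨hx, hxX⟩ := Finset.mem_filter.mp hx
      have g := hP x hx
      refine encT ?_ ?_ ⟨_, g.hv.symm⟩
      · have := Nat.mul_pos (g.N2_pos hn) g.hB
        omega
      · have k1 := Nat.mul_le_mul (g.N2_le hn) (g.B_le hm hn (hs x hx))
        have k2 := Nat.mul_le_mul (g.N3_le hn) (g.A_le hm hn (hs x hx))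
        have : n * (3 * n) = 3 * (n * n) := by ring
        omega
    · intro x hx y hy h1 h2 h3 hq h4 h5
      obtain ⟨hx, hxX⟩ := Finset.mem_filter.mp hx
      obtain ⟨hy, hyX⟩ := Finset.mem_filter.mp hy
      obtain ⟨⟨e1, e2, e3⟩, E1, E2, E3⟩ := base x hx y hy h1 h2 h3
      have gx := hP x hx
      have gy := hP y hy
      rw [hq] at h4
      have eA : (P x).A = (P y).A := encDiv_inj (Nat.mul_pos gy.hA gy.hB).ne'
        (hq ▸ dvd_mul_right _ _) (dvd_mul_right _ _) h4
      have eB : (P x).B = (P y).B := cancel_left gx.hA eA hq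
      have hk : (P x).N2 * (P x).B + (P x).N3 * (P x).A =
          (P y).N2 * (P y).B + (P y).N3 * (P y).A := by rw [E2, E3, eA, eB]
      rw [hk] at h5
      have eE : (P x).E = (P y).E := encDiv_inj
        (by have := Nat.mul_pos (gy.N2_pos hn) gy.hB; omega)
        ⟨(P x).v, by rw [← hk]; exact gx.hv.symm⟩ ⟨_, gy.hv.symm⟩ h5
      have eD : (P x).D = (P y).D := by
        apply cancel_left (a := m * (P x).A * (P x).B * (P x).E)
          (b := m * (P y).A * (P y).B * (P y).E)
        · have := gx.hA; have := gx.hB; have := gx.hE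
          positivity
        · rw [eA, eB, eE]
        · calc _ = m * (P x).A * (P x).B * (P x).D * (P x).E := by ring
            _ = m * (P y).A * (P y).B * (P y).D * (P y).E := by
              rw [gx.heq, gy.heq, E1, E2, E3, eA, eB, eE]
            _ = _ := by ring
      exact eq_of_par gx gy e1 e2 e3 eA eB eD eE
  -- case 2
  have c2 : (s.filter (fun x => (P x).A * (P x).D ≤ X)).card ≤ (X + 1) * T ^ 5 := by
    refine card_le_of_code _ T X (fun x => (P x).A * (P x).D) (fun x => encDiv n (P x).n1)
      (fun x => encDiv n (P x).n2) (fun x => encDiv n (P x).n3)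
      (fun x => encDiv ((P x).A * (P x).D) (P x).A)
      (fun x => encDiv ((P x).N1 * (P x).N2 + m * ((P x).A * (P x).D) * (P x).N3 * (P x).A)
        (P x).v)
      (fun x hx => (Finset.mem_filter.mp hx).2)
      (fun x hx => b1 x (Finset.mem_filter.mp hx).1)
      (fun x hx => b2 x (Finset.mem_filter.mp hx).1)
      (fun x hx => b3 x (Finset.mem_filter.mp hx).1) ?_ ?_ ?_
    · intro x hx
      obtain ⟨hx, hxX⟩ := Finset.mem_filter.mp hx
      exact encT (Nat.mul_pos (hP x hx).hA (hP x hx).hD) (by omega) (dvd_mul_right _ _)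
    · intro x hx
      obtain ⟨hx, hxX⟩ := Finset.mem_filter.mp hx
      have g := hP x hx
      refine encT ?_ ?_ g.v_dvd1
      · have := Nat.mul_pos (g.N1_pos hn) (g.N2_pos hn)
        omega
      · have k0 : m * ((P x).A * (P x).D) ≤ 3 * n := by
          refine le_trans ?_ (g.mABD_le hn (hs x hx))
          calc m * ((P x).A * (P x).D) = m * ((P x).A * (P x).D) * 1 := by ring
            _ ≤ m * ((P x).A * (P x).D) * (P x).B := Nat.mul_le_mul_left _ g.hB
            _ = _ := by ring
        have k1 := Nat.mul_le_mul (g.N1_le hn) (g.N2_le hn)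
        have k2 := Nat.mul_le_mul (Nat.mul_le_mul k0 (g.N3_le hn)) (g.A_le hm hn (hs x hx))
        have : 3 * n * n * (3 * n) = 9 * n ^ 3 := by ring
        omega
    · intro x hx y hy h1 h2 h3 hq h4 h5
      obtain ⟨hx, hxX⟩ := Finset.mem_filter.mp hx
      obtain ⟨hy, hyX⟩ := Finset.mem_filter.mp hy
      obtain ⟨⟨e1, e2, e3⟩, E1, E2, E3⟩ := base x hx y hy h1 h2 h3
      have gx := hP x hx
      have gy := hP y hy
      rw [hq] at h4
      have eA : (P x).A = (P y).A := encDiv_inj (Nat.mul_pos gy.hA gy.hD).ne'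
        (hq ▸ dvd_mul_right _ _) (dvd_mul_right _ _) h4
      have eD : (P x).D = (P y).D := cancel_left gx.hA eA hq
      have hk : (P x).N1 * (P x).N2 + m * ((P x).A * (P x).D) * (P x).N3 * (P x).A =
          (P y).N1 * (P y).N2 + m * ((P y).A * (P y).D) * (P y).N3 * (P y).A := by
        rw [E1, E2, E3, eA, eD]
      have dx := gx.v_dvd1
      rw [hk] at h5 dx
      have ev : (P x).v = (P y).v := encDiv_inj
        (by have := Nat.mul_pos (gy.N1_pos hn) (gy.N2_pos hn); omega) dx gy.v_dvd1 h5
      have eB : (P x).B = (P y).B := by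
        apply cancel_left (a := m * (P x).A * (P x).D) (b := m * (P y).A * (P y).D)
        · have := gx.hA; have := gx.hD
          positivity
        · rw [eA, eD]
        · calc _ = m * (P x).A * (P x).B * (P x).D := by ring
            _ = m * (P y).A * (P y).B * (P y).D := by
              rw [← gx.hv', ← gy.hv', E1, ev]
            _ = _ := by ring
      have eE : (P x).E = (P y).E := by
        apply cancel_left (gx.v_pos hn) ev
        calc _ = (P x).E * (P x).v := by ring
          _ = (P y).E * (P y).v := by rw [gx.hv, gy.hv, E2, E3, eA, eB]
          _ = _ := by ring
      exact eq_of_par gx gy e1 e2 e3 eA eB eD eE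
  -- case 3
  have c3 : (s.filter (fun x => (P x).B * (P x).D ≤ X)).card ≤ (X + 1) * T ^ 5 := by
    refine card_le_of_code _ T X (fun x => (P x).B * (P x).D) (fun x => encDiv n (P x).n1)
      (fun x => encDiv n (P x).n2) (fun x => encDiv n (P x).n3)
      (fun x => encDiv ((P x).B * (P x).D) (P x).B)
      (fun x => encDiv ((P x).N1 * (P x).N3 + m * ((P x).B * (P x).D) * (P x).N2 * (P x).B)
        (P x).v)
      (fun x hx => (Finset.mem_filter.mp hx).2)
      (fun x hx => b1 x (Finset.mem_filter.mp hx).1)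
      (fun x hx => b2 x (Finset.mem_filter.mp hx).1)
      (fun x hx => b3 x (Finset.mem_filter.mp hx).1) ?_ ?_ ?_
    · intro x hx
      obtain ⟨hx, hxX⟩ := Finset.mem_filter.mp hx
      exact encT (Nat.mul_pos (hP x hx).hB (hP x hx).hD) (by omega) (dvd_mul_right _ _)
    · intro x hx
      obtain ⟨hx, hxX⟩ := Finset.mem_filter.mp hx
      have g := hP x hx
      refine encT ?_ ?_ g.v_dvd2
      · have := Nat.mul_pos (g.N1_pos hn) (g.N3_pos hn)
        omega
      · have k0 : m * ((P x).B * (P x).D) ≤ 3 * n := by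
          refine le_trans ?_ (g.mABD_le hn (hs x hx))
          calc m * ((P x).B * (P x).D) = m * ((P x).B * (P x).D) * 1 := by ring
            _ ≤ m * ((P x).B * (P x).D) * (P x).A := Nat.mul_le_mul_left _ g.hA
            _ = _ := by ring
        have k1 := Nat.mul_le_mul (g.N1_le hn) (g.N3_le hn)
        have k2 := Nat.mul_le_mul (Nat.mul_le_mul k0 (g.N2_le hn)) (g.B_le hm hn (hs x hx))
        have : 3 * n * n * (3 * n) = 9 * n ^ 3 := by ring
        omega
    · intro x hx y hy h1 h2 h3 hq h4 h5
      obtain ⟨hx, hxX⟩ := Finset.mem_filter.mp hx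
      obtain ⟨hy, hyX⟩ := Finset.mem_filter.mp hy
      obtain ⟨⟨e1, e2, e3⟩, E1, E2, E3⟩ := base x hx y hy h1 h2 h3
      have gx := hP x hx
      have gy := hP y hy
      rw [hq] at h4
      have eB : (P x).B = (P y).B := encDiv_inj (Nat.mul_pos gy.hB gy.hD).ne'
        (hq ▸ dvd_mul_right _ _) (dvd_mul_right _ _) h4
      have eD : (P x).D = (P y).D := cancel_left gx.hB eB hq
      have hk : (P x).N1 * (P x).N3 + m * ((P x).B * (P x).D) * (P x).N2 * (P x).B =
          (P y).N1 * (P y).N3 + m * ((P y).B * (P y).D) * (P y).N2 * (P y).B := by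
        rw [E1, E2, E3, eB, eD]
      have dx := gx.v_dvd2
      rw [hk] at h5 dx
      have ev : (P x).v = (P y).v := encDiv_inj
        (by have := Nat.mul_pos (gy.N1_pos hn) (gy.N3_pos hn); omega) dx gy.v_dvd2 h5
      have eA : (P x).A = (P y).A := by
        apply cancel_left (a := m * (P x).B * (P x).D) (b := m * (P y).B * (P y).D)
        · have := gx.hB; have := gx.hD
          positivity
        · rw [eB, eD]
        · calc _ = m * (P x).A * (P x).B * (P x).D := by ring
            _ = m * (P y).A * (P y).B * (P y).D := by
              rw [← gx.hv', ← gy.hv', E1, ev]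
            _ = _ := by ring
      have eE : (P x).E = (P y).E := by
        apply cancel_left (gx.v_pos hn) ev
        calc _ = (P x).E * (P x).v := by ring
          _ = (P y).E * (P y).v := by rw [gx.hv, gy.hv, E2, E3, eA, eB]
          _ = _ := by ring
      exact eq_of_par gx gy e1 e2 e3 eA eB eD eE
  -- case 4
  have c4 : (s.filter (fun x => (P x).v ≤ X)).card ≤ (X + 1) * T ^ 5 := by
    have dA : ∀ x ∈ s, (P x).A ∣ (P x).v + (P x).N1 := fun x hx =>
      ⟨m * (P x).B * (P x).D, by rw [(hP x hx).hv']; ring⟩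
    have dB : ∀ x ∈ s, (P x).B ∣ (P x).v + (P x).N1 := fun x hx =>
      ⟨m * (P x).A * (P x).D, by rw [(hP x hx).hv']; ring⟩
    have hpos : ∀ x ∈ s, 0 < (P x).v + (P x).N1 := fun x hx => by
      have := (hP x hx).N1_pos hn
      omega
    have hle : ∀ x ∈ s, (P x).v + (P x).N1 ≤ 10 * n ^ 3 := fun x hx => by
      rw [(hP x hx).hv']
      have := (hP x hx).mABD_le hn (hs x hx)
      omega
    refine card_le_of_code _ T X (fun x => (P x).v) (fun x => encDiv n (P x).n1)
      (fun x => encDiv n (P x).n2) (fun x => encDiv n (P x).n3)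
      (fun x => encDiv ((P x).v + (P x).N1) (P x).A)
      (fun x => encDiv ((P x).v + (P x).N1) (P x).B)
      (fun x hx => (Finset.mem_filter.mp hx).2)
      (fun x hx => b1 x (Finset.mem_filter.mp hx).1)
      (fun x hx => b2 x (Finset.mem_filter.mp hx).1)
      (fun x hx => b3 x (Finset.mem_filter.mp hx).1) ?_ ?_ ?_
    · intro x hx
      have hx := (Finset.mem_filter.mp hx).1
      exact encT (hpos x hx) (hle x hx) (dA x hx)
    · intro x hx
      have hx := (Finset.mem_filter.mp hx).1
      exact encT (hpos x hx) (hle x hx) (dB x hx)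
    · intro x hx y hy h1 h2 h3 hq h4 h5
      obtain ⟨hx, hxX⟩ := Finset.mem_filter.mp hx
      obtain ⟨hy, hyX⟩ := Finset.mem_filter.mp hy
      obtain ⟨⟨e1, e2, e3⟩, E1, E2, E3⟩ := base x hx y hy h1 h2 h3
      have gx := hP x hx
      have gy := hP y hy
      have hk : (P x).v + (P x).N1 = (P y).v + (P y).N1 := by rw [hq, E1]
      have dAx := dA x hx
      have dBx := dB x hx
      rw [hk] at h4 h5 dAx dBx
      have eA := encDiv_inj (hpos y hy).ne' dAx (dA y hy) h4
      have eB := encDiv_inj (hpos y hy).ne' dBx (dB y hy) h5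
      have eD : (P x).D = (P y).D := by
        apply cancel_left (a := m * (P x).A * (P x).B) (b := m * (P y).A * (P y).B)
        · have := gx.hA; have := gx.hB
          positivity
        · rw [eA, eB]
        · rw [← gx.hv', ← gy.hv', hk]
      have eE : (P x).E = (P y).E := by
        apply cancel_left (gx.v_pos hn) hq
        calc _ = (P x).E * (P x).v := by ring
          _ = (P y).E * (P y).v := by rw [gx.hv, gy.hv, E2, E3, eA, eB]
          _ = _ := by ring
      exact eq_of_par gx gy e1 e2 e3 eA eB eD eE
  -- case 5
  have c5 : (s.filter (fun x => (P x).w ≤ X)).card ≤ (X + 1) * T ^ 5 := by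
    have dB : ∀ x ∈ s, (P x).B ∣ Nat.gcd (P x).N1 (P x).N2 * (P x).w + (P x).N3 := fun x hx =>
      ⟨m * (P x).E * (P x).D, by rw [(hP x hx).hw']; ring⟩
    have dE : ∀ x ∈ s, (P x).E ∣ Nat.gcd (P x).N1 (P x).N2 * (P x).w + (P x).N3 := fun x hx =>
      ⟨m * (P x).B * (P x).D, by rw [(hP x hx).hw']; ring⟩
    have hpos : ∀ x ∈ s, 0 < Nat.gcd (P x).N1 (P x).N2 * (P x).w + (P x).N3 := fun x hx => by
      have := (hP x hx).N3_pos hn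
      omega
    have hle : ∀ x ∈ s, (P x).w ≤ X →
        Nat.gcd (P x).N1 (P x).N2 * (P x).w + (P x).N3 ≤ 10 * n ^ 3 := fun x hx hw => by
      have g := hP x hx
      have k1 : Nat.gcd (P x).N1 (P x).N2 ≤ n :=
        (Nat.le_of_dvd (g.N1_pos hn) (Nat.gcd_dvd_left _ _)).trans (g.N1_le hn)
      have k2 := Nat.mul_le_mul k1 (hw.trans hXn)
      have k3 := g.N3_le hn
      have : n * (4 * n) = 4 * (n * n) := by ring
      omega
    refine card_le_of_code _ T X (fun x => (P x).w) (fun x => encDiv n (P x).n1)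
      (fun x => encDiv n (P x).n2) (fun x => encDiv n (P x).n3)
      (fun x => encDiv (Nat.gcd (P x).N1 (P x).N2 * (P x).w + (P x).N3) (P x).B)
      (fun x => encDiv (Nat.gcd (P x).N1 (P x).N2 * (P x).w + (P x).N3) (P x).E)
      (fun x hx => (Finset.mem_filter.mp hx).2)
      (fun x hx => b1 x (Finset.mem_filter.mp hx).1)
      (fun x hx => b2 x (Finset.mem_filter.mp hx).1)
      (fun x hx => b3 x (Finset.mem_filter.mp hx).1) ?_ ?_ ?_
    · intro x hx
      obtain ⟨hx, hxX⟩ := Finset.mem_filter.mp hx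
      exact encT (hpos x hx) (hle x hx hxX) (dB x hx)
    · intro x hx
      obtain ⟨hx, hxX⟩ := Finset.mem_filter.mp hx
      exact encT (hpos x hx) (hle x hx hxX) (dE x hx)
    · intro x hx y hy h1 h2 h3 hq h4 h5
      obtain ⟨hx, hxX⟩ := Finset.mem_filter.mp hx
      obtain ⟨hy, hyX⟩ := Finset.mem_filter.mp hy
      obtain ⟨⟨e1, e2, e3⟩, E1, E2, E3⟩ := base x hx y hy h1 h2 h3
      have gx := hP x hx
      have gy := hP y hy
      have hg : Nat.gcd (P x).N1 (P x).N2 * (P x).w = Nat.gcd (P y).N1 (P y).N2 * (P y).w := by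
        rw [hq, E1, E2]
      have hk : Nat.gcd (P x).N1 (P x).N2 * (P x).w + (P x).N3 =
          Nat.gcd (P y).N1 (P y).N2 * (P y).w + (P y).N3 := by rw [hg, E3]
      have dBx := dB x hx
      have dEx := dE x hx
      rw [hk] at h4 h5 dBx dEx
      have eB := encDiv_inj (hpos y hy).ne' dBx (dB y hy) h4
      have eE := encDiv_inj (hpos y hy).ne' dEx (dE y hy) h5
      have eD : (P x).D = (P y).D := by
        apply cancel_left (a := m * (P x).B * (P x).E) (b := m * (P y).B * (P y).E)
        · have := gx.hB; have := gx.hE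
          positivity
        · rw [eB, eE]
        · rw [← gx.hw', ← gy.hw', hk]
      have eA : (P x).A = (P y).A := by
        apply cancel_left (gx.gw_pos hn) hg
        calc _ = (P x).A * (Nat.gcd (P x).N1 (P x).N2 * (P x).w) := by ring
          _ = (P y).A * (Nat.gcd (P y).N1 (P y).N2 * (P y).w) := by
            rw [gx.hw, gy.hw, E1, E2, eB, eE]
          _ = _ := by ring
      exact eq_of_par gx gy e1 e2 e3 eA eB eD eE
  -- conclusion
  have hcover : s ⊆ s.filter (fun x => (P x).A * (P x).B ≤ X) ∪
      (s.filter (fun x => (P x).A * (P x).D ≤ X) ∪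
      (s.filter (fun x => (P x).B * (P x).D ≤ X) ∪
      (s.filter (fun x => (P x).v ≤ X) ∪ s.filter (fun x => (P x).w ≤ X)))) := by
    intro x hx
    have := (hP x hx).five_cases hm hn (hs x hx) hX
    simp only [Finset.mem_union, Finset.mem_filter]
    tauto
  have h0 := Finset.card_le_card hcover
  have u1 := Finset.card_union_le (s.filter (fun x => (P x).A * (P x).B ≤ X))
      (s.filter (fun x => (P x).A * (P x).D ≤ X) ∪
      (s.filter (fun x => (P x).B * (P x).D ≤ X) ∪
      (s.filter (fun x => (P x).v ≤ X) ∪ s.filter (fun x => (P x).w ≤ X))))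
  have u2 := Finset.card_union_le (s.filter (fun x => (P x).A * (P x).D ≤ X))
      (s.filter (fun x => (P x).B * (P x).D ≤ X) ∪
      (s.filter (fun x => (P x).v ≤ X) ∪ s.filter (fun x => (P x).w ≤ X)))
  have u3 := Finset.card_union_le (s.filter (fun x => (P x).B * (P x).D ≤ X))
      (s.filter (fun x => (P x).v ≤ X) ∪ s.filter (fun x => (P x).w ≤ X))
  have u4 := Finset.card_union_le (s.filter (fun x => (P x).v ≤ X))
      (s.filter (fun x => (P x).w ≤ X))
  omega

/-- The number of representations by three unit fractions is `O(n ^ (11/17))`. -/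
lemma three_bound : ∃ K : ℝ, 1 ≤ K ∧ ∀ m n : ℕ, 0 < m → 0 < n → ∀ s : Finset (ℕ × ℕ × ℕ),
    (∀ x ∈ s, IsSol m n x.1 x.2.1 x.2.2) → (s.card : ℝ) ≤ K * (n : ℝ) ^ ((11 : ℝ) / 17) := by
  obtain ⟨K, hK, hdiv⟩ := divisor_bound (1 / 400) (by norm_num)
  refine ⟨250 * K ^ 5, by nlinarith [one_le_pow₀ (n := 5) hK], fun m n hm hn s hs => ?_⟩
  have hn1 : (1 : ℝ) ≤ n := by exact_mod_cast hn
  have hn0 : (0 : ℝ) < n := by linarith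
  set R : ℝ := (n : ℝ) ^ ((3 : ℝ) / 5) with hR
  have hR1 : 1 ≤ R := Real.one_le_rpow hn1 (by norm_num)
  have hRn : R ≤ n := by
    calc R ≤ (n : ℝ) ^ (1 : ℝ) := Real.rpow_le_rpow_of_exponent_le hn1 (by norm_num)
      _ = n := Real.rpow_one _
  have hR5 : R ^ 5 = (n : ℝ) ^ 3 := by
    rw [hR, ← Real.rpow_natCast, ← Real.rpow_mul hn0.le, ← Real.rpow_natCast]
    norm_num
  set X : ℕ := ⌈3 * R⌉₊ with hXdef
  have hX1 : 3 * R ≤ X := Nat.le_ceil _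
  have hX2 : (X : ℝ) < 3 * R + 1 := Nat.ceil_lt_add_one (by linarith)
  have hX : 36 * n ^ 3 ≤ X ^ 5 := by
    have : (36 : ℝ) * n ^ 3 ≤ (X : ℝ) ^ 5 := by
      calc (36 : ℝ) * n ^ 3 = 36 * R ^ 5 := by rw [hR5]
        _ ≤ (3 * R) ^ 5 := by
          have : 0 ≤ R ^ 5 := by positivity
          nlinarith
        _ ≤ _ := by gcongr
    exact_mod_cast this
  have hXn : X ≤ 4 * n := by
    have : (X : ℝ) ≤ 4 * n := by linarith
    exact_mod_cast this
  set Z : ℝ := (10 * (n : ℝ) ^ 3) ^ ((1 : ℝ) / 400) with hZ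
  have hZ0 : 0 ≤ Z := by positivity
  have hT : ∀ y, y ≤ 10 * n ^ 3 → y.divisors.card ≤ ⌊K * Z⌋₊ := by
    intro y hy
    rcases Nat.eq_zero_or_pos y with rfl | hy0
    · simp
    · apply Nat.le_floor
      refine (hdiv y hy0.ne').trans ?_
      have : (y : ℝ) ≤ 10 * (n : ℝ) ^ 3 := by exact_mod_cast hy
      rw [hZ]
      gcongr
  have hcount := count_three hm hn hX hXn hT s hs
  have hcR : (s.card : ℝ) ≤ 5 * (((X : ℝ) + 1) * (⌊K * Z⌋₊ : ℝ) ^ 5) := by exact_mod_cast hcount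
  have hfl : (⌊K * Z⌋₊ : ℝ) ≤ K * Z := Nat.floor_le (by positivity)
  have hZ5 : Z ^ 5 ≤ 10 * (n : ℝ) ^ ((3 : ℝ) / 80) := by
    have h10 : ((10 : ℝ) ^ ((1 : ℝ) / 400)) ^ 5 ≤ 10 := by
      rw [← Real.rpow_natCast, ← Real.rpow_mul (by norm_num)]
      calc (10 : ℝ) ^ ((1 : ℝ) / 400 * ((5 : ℕ) : ℝ)) ≤ (10 : ℝ) ^ (1 : ℝ) :=
            Real.rpow_le_rpow_of_exponent_le (by norm_num) (by norm_num)
        _ = 10 := Real.rpow_one _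
    have hnn : (((n : ℝ) ^ 3) ^ ((1 : ℝ) / 400)) ^ 5 = (n : ℝ) ^ ((3 : ℝ) / 80) := by
      rw [← Real.rpow_natCast (n : ℝ) 3, ← Real.rpow_mul hn0.le, ← Real.rpow_natCast,
        ← Real.rpow_mul hn0.le]
      norm_num
    rw [hZ, Real.mul_rpow (by norm_num) (by positivity), mul_pow, hnn]
    gcongr
  have hRn2 : R * (n : ℝ) ^ ((3 : ℝ) / 80) ≤ (n : ℝ) ^ ((11 : ℝ) / 17) := by
    rw [hR, ← Real.rpow_add hn0]
    exact Real.rpow_le_rpow_of_exponent_le hn1 (by norm_num)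
  calc (s.card : ℝ) ≤ 5 * (((X : ℝ) + 1) * (⌊K * Z⌋₊ : ℝ) ^ 5) := hcR
    _ ≤ 5 * ((5 * R) * (K * Z) ^ 5) := by
      gcongr
      linarith
    _ = 25 * K ^ 5 * R * Z ^ 5 := by ring
    _ ≤ 25 * K ^ 5 * R * (10 * (n : ℝ) ^ ((3 : ℝ) / 80)) := by gcongr
    _ = 250 * K ^ 5 * (R * (n : ℝ) ^ ((3 : ℝ) / 80)) := by ring
    _ ≤ _ := by gcongr

/-! ### The theorem of Curtiss -/

lemma u_pos (n : ℕ) : 0 < u n := by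
  induction n with
  | zero => simp [u]
  | succ n ih => simp only [u]; positivity

lemma prod_u (n : ℕ) : ∏ i ∈ Finset.range n, ((u i : ℝ) + 1) = u n := by
  induction n with
  | zero => simp [u]
  | succ n ih => rw [Finset.prod_range_succ, ih, u]; push_cast; ring

lemma sum_u (n : ℕ) : ∑ i ∈ Finset.range n, 1 / ((u i : ℝ) + 1) = 1 - 1 / u n := by
  induction n with
  | zero => simp [u]
  | succ n ih =>
    have : (0 : ℝ) < u n := by exact_mod_cast u_pos n
    rw [Finset.sum_range_succ, ih, u]
    push_cast
    field_simp
    ring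

lemma sum_frac {ι : Type*} (S : Finset ι) (f : ι → ℕ) (hf : ∀ i ∈ S, 0 < f i) :
    ∃ M : ℕ, ∑ i ∈ S, (1 : ℝ) / f i = M / ((∏ i ∈ S, f i : ℕ) : ℝ) := by
  classical
  induction S using Finset.induction_on with
  | empty => exact ⟨0, by simp⟩
  | insert a S ha ih =>
    obtain ⟨M, hM⟩ := ih (fun i hi => hf i (Finset.mem_insert_of_mem hi))
    refine ⟨(∏ i ∈ S, f i) + f a * M, ?_⟩
    have h1 : (0 : ℝ) < f a := by exact_mod_cast hf a (Finset.mem_insert_self _ _)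
    have h2 : (0 : ℝ) < ((∏ i ∈ S, f i : ℕ) : ℝ) := by
      exact_mod_cast Finset.prod_pos (fun i hi => hf i (Finset.mem_insert_of_mem hi))
    rw [Finset.sum_insert ha, Finset.prod_insert ha, hM]
    push_cast at h2 ⊢
    field_simp

lemma abel_nonneg (y z : ℕ → ℝ) (N : ℕ) (hy : ∀ i, i ≤ N → 0 ≤ y i)
    (hanti : ∀ i, i < N → y (i + 1) ≤ y i)
    (hz : ∀ i, i ≤ N + 1 → 0 ≤ ∑ j ∈ Finset.range i, z j) :
    y N * ∑ j ∈ Finset.range (N + 1), z j ≤ ∑ j ∈ Finset.range (N + 1), y j * z j := by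
  induction N with
  | zero => simp
  | succ N ih =>
    have h1 := ih (fun i hi => hy i (by omega)) (fun i hi => hanti i (by omega))
      (fun i hi => hz i (by omega))
    rw [Finset.sum_range_succ _ (N + 1), Finset.sum_range_succ _ (N + 1)]
    have h2 := hz (N + 1) (by omega)
    have h3 := hanti N (by omega)
    nlinarith

lemma majorize (x y : ℕ → ℝ) (N : ℕ) (hx : ∀ i, i < N → 0 < x i) (hy : ∀ i, i < N → 0 < y i)
    (hanti : ∀ i, i + 1 < N → y (i + 1) ≤ y i)
    (hp : ∀ i, i ≤ N → ∏ j ∈ Finset.range i, y j ≤ ∏ j ∈ Finset.range i, x j) :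
    ∑ j ∈ Finset.range N, y j ≤ ∑ j ∈ Finset.range N, x j := by
  rcases N with _ | N
  · simp
  have hz : ∀ i, i ≤ N + 1 → 0 ≤ ∑ j ∈ Finset.range i, Real.log (x j / y j) := by
    intro i hi
    have hj : ∀ j ∈ Finset.range i, j < N + 1 := fun j hj =>
      (Finset.mem_range.mp hj).trans_le hi
    rw [← Real.log_prod (fun j hj' =>
      (div_pos (hx j (hj j hj')) (hy j (hj j hj'))).ne')]
    apply Real.log_nonneg
    rw [Finset.prod_div_distrib, le_div_iff₀ (Finset.prod_pos (fun j hj' => hy j (hj j hj'))),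
      one_mul]
    exact hp i hi
  have h1 := abel_nonneg y (fun j => Real.log (x j / y j)) N
    (fun i hi => (hy i (by omega)).le) (fun i hi => hanti i (by omega)) hz
  have h2 : 0 ≤ y N * ∑ j ∈ Finset.range (N + 1), Real.log (x j / y j) :=
    mul_nonneg (hy N (by omega)).le (hz _ le_rfl)
  have h3 : ∑ j ∈ Finset.range (N + 1), y j * Real.log (x j / y j) ≤
      ∑ j ∈ Finset.range (N + 1), (x j - y j) := by
    apply Finset.sum_le_sum
    intro j hj
    have hj := Finset.mem_range.mp hj
    have hxj := hx j hj
    have hyj := hy j hj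
    have h4 := Real.log_le_sub_one_of_pos (div_pos hxj hyj)
    calc y j * Real.log (x j / y j) ≤ y j * (x j / y j - 1) := by gcongr
      _ = x j - y j := by field_simp
  rw [Finset.sum_sub_distrib] at h3
  linarith

lemma curtiss (a : ℕ → ℕ) (n : ℕ) (hpos : ∀ i, i < n → 0 < a i)
    (hmono : ∀ i j, i ≤ j → j < n → a i ≤ a j)
    (hlt : ∑ i ∈ Finset.range n, (1 : ℝ) / a i < 1) :
    ∑ i ∈ Finset.range n, (1 : ℝ) / a i ≤ ∑ i ∈ Finset.range n, 1 / ((u i : ℝ) + 1) := by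
  induction n using Nat.strong_induction_on with
  | _ n ih =>
  rcases Nat.eq_zero_or_pos n with rfl | hn
  · simp
  have haR : ∀ i, i < n → (0 : ℝ) < a i := fun i hi => by exact_mod_cast hpos i hi
  have huR : ∀ i, (0 : ℝ) < (u i : ℝ) + 1 := fun i => by positivity
  by_cases hprod : ∏ i ∈ Finset.range n, (a i : ℝ) ≤ u n
  · obtain ⟨M, hM⟩ := sum_frac (Finset.range n) a (fun i hi => hpos i (Finset.mem_range.mp hi))
    have hQ : (0 : ℝ) < ((∏ i ∈ Finset.range n, a i : ℕ) : ℝ) := by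
      exact_mod_cast Finset.prod_pos (fun i hi => hpos i (Finset.mem_range.mp hi))
    have hQu : ((∏ i ∈ Finset.range n, a i : ℕ) : ℝ) ≤ u n := by
      push_cast
      exact hprod
    rw [hM, sum_u]
    rw [hM, div_lt_one hQ] at hlt
    have hlt' : (M : ℝ) + 1 ≤ ((∏ i ∈ Finset.range n, a i : ℕ) : ℝ) := by exact_mod_cast hlt
    generalize ((∏ i ∈ Finset.range n, a i : ℕ) : ℝ) = Q at *
    have h1 : 1 / (u n : ℝ) ≤ 1 / Q := one_div_le_one_div_of_le hQ hQu
    have h2 : (M : ℝ) / Q + 1 / Q ≤ 1 := by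
      rw [← add_div, div_le_one hQ]
      exact hlt'
    linarith
  · push Not at hprod
    classical
    let P : ℕ → Prop := fun l => ∏ i ∈ Finset.Ico l n, ((u i : ℝ) + 1) ≤
      ∏ i ∈ Finset.Ico l n, (a i : ℝ)
    have hP0 : P 0 := by
      simp only [P, ← Finset.range_eq_Ico]
      rw [prod_u]
      exact hprod.le
    set l := Nat.findGreatest P (n - 1) with hl
    have hPl : P l := Nat.findGreatest_spec (Nat.zero_le _) hP0
    have hln : l < n := by
      have := Nat.findGreatest_le (P := P) (n - 1)
      omega
    have hmax : ∀ i, l < i → i < n → ¬ P i := fun i h1 h2 =>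
      Nat.findGreatest_is_greatest h1 (by omega)
    have hseg : ∀ i, l ≤ i → i ≤ n → ∏ j ∈ Finset.Ico l i, ((u j : ℝ) + 1) ≤
        ∏ j ∈ Finset.Ico l i, (a j : ℝ) := by
      intro i h1 h2
      rcases h1.eq_or_lt with rfl | h1
      · simp
      rcases h2.eq_or_lt with rfl | h2
      · exact hPl
      have h3 := hmax i h1 h2
      simp only [P, not_le] at h3
      have h4 : ∏ j ∈ Finset.Ico l n, ((u j : ℝ) + 1) ≤ ∏ j ∈ Finset.Ico l n, (a j : ℝ) := hPl
      rw [← Finset.prod_Ico_consecutive _ h1.le h2.le,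
        ← Finset.prod_Ico_consecutive _ h1.le h2.le] at h4
      have p1 : 0 < ∏ j ∈ Finset.Ico i n, ((u j : ℝ) + 1) := Finset.prod_pos fun j _ => huR j
      have p2 : 0 < ∏ j ∈ Finset.Ico l i, (a j : ℝ) := Finset.prod_pos fun j hj =>
        haR j ((Finset.mem_Ico.mp hj).2.trans h2)
      by_contra hcon
      push Not at hcon
      nlinarith
    have htail : ∑ i ∈ Finset.Ico l n, (1 : ℝ) / a i ≤
        ∑ i ∈ Finset.Ico l n, 1 / ((u i : ℝ) + 1) := by
      rw [Finset.sum_Ico_eq_sum_range, Finset.sum_Ico_eq_sum_range]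
      apply majorize
      · intro i _
        have := huR (l + i)
        positivity
      · intro i hi
        have := haR (l + i) (by omega)
        positivity
      · intro i hi
        apply one_div_le_one_div_of_le (haR _ (by omega))
        exact_mod_cast hmono (l + i) (l + (i + 1)) (by omega) (by omega)
      · intro i hi
        have h1 := hseg (l + i) (by omega) (by omega)
        rw [Finset.prod_Ico_eq_prod_range, Finset.prod_Ico_eq_prod_range,
          Nat.add_sub_cancel_left] at h1
        simp only [one_div]
        rw [Finset.prod_inv_distrib, Finset.prod_inv_distrib]
        apply inv_anti₀ _ h1
        exact Finset.prod_pos fun j _ => huR _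
    have hsplit : ∀ f : ℕ → ℝ, ∑ i ∈ Finset.range n, f i =
        ∑ i ∈ Finset.range l, f i + ∑ i ∈ Finset.Ico l n, f i := fun f =>
      (Finset.sum_range_add_sum_Ico f hln.le).symm
    have htpos : 0 ≤ ∑ i ∈ Finset.Ico l n, (1 : ℝ) / a i :=
      Finset.sum_nonneg fun i _ => by positivity
    have hhead := ih l hln (fun i hi => hpos i (by omega))
      (fun i j h1 h2 => hmono i j h1 (by omega)) (by
        rw [hsplit] at hlt
        linarith)
    rw [hsplit, hsplit (fun i => 1 / ((u i : ℝ) + 1))]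
    linarith

/-! ### Assembling the count -/

def extTuple {k : ℕ} (a : Fin k → ℕ) (i : ℕ) : ℕ := if h : i < k then a ⟨i, h⟩ else 1

lemma extTuple_fin {k : ℕ} (a : Fin k → ℕ) (i : Fin k) : extTuple a i = a i := by
  simp [extTuple]

structure IsChain1 (k : ℕ) (b : ℕ → ℕ) : Prop where
  pos : ∀ i, i < k → 0 < b i
  mono : ∀ i j, i ≤ j → j < k → b i ≤ b j
  sum : ∑ i ∈ Finset.range k, (1 : ℝ) / b i = 1

lemma extTuple_chain {k : ℕ} (a : Fin k → ℕ) (hpos : ∀ i, 0 < a i) (hmono : Monotone a)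
    (hsum : ((1 : ℕ) : ℚ) / (1 : ℕ) = ∑ i, (1 : ℚ) / a i) : IsChain1 k (extTuple a) := by
  refine ⟨fun i hi => ?_, fun i j hij hj => ?_, ?_⟩
  · simp only [extTuple, hi, dif_pos]
    exact hpos _
  · simp only [extTuple, hj, hij.trans_lt hj, dif_pos]
    exact hmono (by simpa using hij)
  · rw [Finset.sum_range]
    simp only [extTuple_fin]
    have h := congrArg (fun q : ℚ => (q : ℝ)) hsum
    push_cast at h
    rw [← h]
    norm_num

lemma IsChain1.le {k : ℕ} {b : ℕ → ℕ} (h : IsChain1 k b) {i : ℕ} (hi : i < k) :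
    b i ≤ k * u i := by
  have hbi : (0 : ℝ) < b i := by exact_mod_cast h.pos i hi
  have hui : (0 : ℝ) < u i := by exact_mod_cast u_pos i
  have hsplit := Finset.sum_range_add_sum_Ico (fun j => (1 : ℝ) / b j) hi.le
  rw [h.sum] at hsplit
  have hge : (1 : ℝ) / b i ≤ ∑ j ∈ Finset.Ico i k, (1 : ℝ) / b j :=
    Finset.single_le_sum (f := fun j => (1 : ℝ) / b j) (fun j _ => by positivity)
      (Finset.mem_Ico.mpr ⟨le_rfl, hi⟩)
  have hb0 : (0 : ℝ) < 1 / b i := by positivity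
  have hc := curtiss b i (fun j hj => h.pos j (hj.trans hi))
    (fun j l h1 h2 => h.mono j l h1 (h2.trans hi)) (by linarith)
  rw [sum_u] at hc
  have hle : ∑ j ∈ Finset.Ico i k, (1 : ℝ) / b j ≤ k * (1 / b i) := by
    calc ∑ j ∈ Finset.Ico i k, (1 : ℝ) / b j ≤ ∑ j ∈ Finset.Ico i k, (1 : ℝ) / b i := by
          apply Finset.sum_le_sum
          intro j hj
          obtain ⟨h1, h2⟩ := Finset.mem_Ico.mp hj
          apply one_div_le_one_div_of_le hbi
          exact_mod_cast h.mono i j h1 h2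
      _ = ((k - i : ℕ) : ℝ) * (1 / b i) := by
          rw [Finset.sum_const, Nat.card_Ico, nsmul_eq_mul]
      _ ≤ _ := by
          gcongr
          omega
  have hfin : 1 / (u i : ℝ) ≤ k * (1 / b i) := by linarith
  have : (b i : ℝ) ≤ k * u i := by
    rw [mul_one_div, div_le_div_iff₀ hui hbi] at hfin
    linarith
  exact_mod_cast this

lemma IsChain1.isSol {r m n : ℕ} {b : ℕ → ℕ} (h : IsChain1 (r + 3) b) (hn : 0 < n)
    (hr : ∑ i ∈ Finset.range r, (1 : ℝ) / b i = 1 - (m : ℝ) / n) :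
    IsSol m n (b r) (b (r + 1)) (b (r + 2)) := by
  refine ⟨h.pos _ (by omega), h.mono _ _ (by omega) (by omega),
    h.mono _ _ (by omega) (by omega), ?_⟩
  have hs := h.sum
  rw [Finset.sum_range_succ, Finset.sum_range_succ, Finset.sum_range_succ, hr] at hs
  have h0 : (0 : ℝ) < b r := by exact_mod_cast h.pos r (by omega)
  have h1 : (0 : ℝ) < b (r + 1) := by exact_mod_cast h.pos (r + 1) (by omega)
  have h2 : (0 : ℝ) < b (r + 2) := by exact_mod_cast h.pos (r + 2) (by omega)
  have hn' : (0 : ℝ) < n := by exact_mod_cast hn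
  have hs' : (m : ℝ) / n = 1 / b r + 1 / b (r + 1) + 1 / b (r + 2) := by linarith
  field_simp at hs'
  have : (m : ℝ) * b r * b (r + 1) * b (r + 2) =
      n * (b (r + 1) * b (r + 2) + b r * b (r + 2) + b r * b (r + 1)) := by linarith
  exact_mod_cast this

lemma count_k : ∃ K : ℝ, 1 ≤ K ∧ ∀ r : ℕ, (numSols (r + 3) 1 1 : ℝ) ≤
    K * ((∏ i ∈ Finset.range r, ((r + 3) * u i) : ℕ) : ℝ) ^ ((28 : ℝ) / 17) := by
  classical
  obtain ⟨K, hK, hthree⟩ := three_bound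
  refine ⟨K, hK, fun r => ?_⟩
  set W : ℕ := ∏ i ∈ Finset.range r, ((r + 3) * u i) with hW
  have hW0 : 0 < W := Finset.prod_pos fun i _ => Nat.mul_pos (by omega) (u_pos i)
  have hWR : (0 : ℝ) < W := by exact_mod_cast hW0
  unfold numSols
  by_cases hfin : Finite {a : Fin (r + 3) → ℕ // (∀ i, 0 < a i) ∧ Monotone a ∧
    ((1 : ℕ) : ℚ) / (1 : ℕ) = ∑ i, (1 : ℚ) / a i}
  swap
  · rw [not_finite_iff_infinite] at hfin
    rw [Nat.card_eq_zero_of_infinite]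
    simp only [Nat.cast_zero]
    positivity
  have hfs : {a : Fin (r + 3) → ℕ | (∀ i, 0 < a i) ∧ Monotone a ∧
    ((1 : ℕ) : ℚ) / (1 : ℕ) = ∑ i, (1 : ℚ) / a i}.Finite := hfin
  set s := hfs.toFinset with hs
  have hcard : Nat.card {a : Fin (r + 3) → ℕ // (∀ i, 0 < a i) ∧ Monotone a ∧
      ((1 : ℕ) : ℚ) / (1 : ℕ) = ∑ i, (1 : ℚ) / a i} = s.card :=
    Nat.card_eq_card_finite_toFinset hfs
  rw [hcard]
  have hch : ∀ a ∈ s, IsChain1 (r + 3) (extTuple a) := by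
    intro a ha
    obtain ⟨h1, h2, h3⟩ := hfs.mem_toFinset.mp ha
    exact extTuple_chain a h1 h2 h3
  have hmaps : ∀ a ∈ s, (fun i : Fin r => extTuple a i) ∈
      Fintype.piFinset (fun i : Fin r => Finset.Icc 1 ((r + 3) * u i)) := by
    intro a ha
    rw [Fintype.mem_piFinset]
    intro i
    exact Finset.mem_Icc.mpr ⟨(hch a ha).pos i (by omega), (hch a ha).le (by omega)⟩
  have hcount := Finset.card_le_mul_card_image_of_maps_to hmaps
    ⌊K * (W : ℝ) ^ ((11 : ℝ) / 17)⌋₊ (by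
      intro p hp
      rw [Fintype.mem_piFinset] at hp
      apply Nat.le_floor
      rcases (s.filter (fun a => (fun i : Fin r => extTuple a i) = p)).eq_empty_or_nonempty
        with he | ⟨a0, ha0⟩
      · rw [he]
        simp only [Finset.card_empty, Nat.cast_zero]
        positivity
      have hppos : ∀ i, 0 < p i := fun i => (Finset.mem_Icc.mp (hp i)).1
      set n : ℕ := ∏ i, p i with hn
      have hn0 : 0 < n := Finset.prod_pos fun i _ => hppos i
      have hnR : (0 : ℝ) < n := by exact_mod_cast hn0
      obtain ⟨M, hM⟩ := sum_frac Finset.univ p (fun i _ => hppos i)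
      rw [← hn] at hM
      have hpre : ∀ a ∈ s.filter (fun a => (fun i : Fin r => extTuple a i) = p),
          ∑ i ∈ Finset.range r, (1 : ℝ) / extTuple a i = M / n := by
        intro a ha
        have h1 := (Finset.mem_filter.mp ha).2
        rw [← hM, Finset.sum_range, ← h1]
      have hMn : M < n := by
        have hc := hch a0 (Finset.mem_filter.mp ha0).1
        have h1 := hc.sum
        rw [Finset.sum_range_succ, Finset.sum_range_succ, Finset.sum_range_succ,
          hpre a0 ha0] at h1
        have h0 : (0 : ℝ) < extTuple a0 r := by exact_mod_cast hc.pos r (by omega)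
        have h0' : (0 : ℝ) < 1 / extTuple a0 r := by positivity
        have h2 : (0 : ℝ) ≤ 1 / extTuple a0 (r + 1) := by positivity
        have h3 : (0 : ℝ) ≤ 1 / extTuple a0 (r + 2) := by positivity
        have h4 : (M : ℝ) / n < 1 := by linarith
        rw [div_lt_one hnR] at h4
        exact_mod_cast h4
      have hb := hthree (n - M) n (by omega) hn0
        ((s.filter (fun a => (fun i : Fin r => extTuple a i) = p)).image
          (fun a => (extTuple a r, extTuple a (r + 1), extTuple a (r + 2)))) (by
          intro x hx
          obtain ⟨a, ha, rfl⟩ := Finset.mem_image.mp hx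
          refine (hch a (Finset.mem_filter.mp ha).1).isSol hn0 ?_
          rw [hpre a ha, Nat.cast_sub hMn.le]
          field_simp
          ring)
      rw [Finset.card_image_of_injOn] at hb
      · refine hb.trans ?_
        have hnW : (n : ℝ) ≤ W := by
          rw [hn, hW, Finset.prod_range]
          exact_mod_cast Finset.prod_le_prod' fun i _ => (Finset.mem_Icc.mp (hp i)).2
        gcongr
      · intro a ha a' ha' heq
        have e1 := (Finset.mem_filter.mp ha).2
        have e2 := (Finset.mem_filter.mp ha').2
        simp only [Prod.mk.injEq] at heq
        obtain ⟨q0, q1, q2⟩ := heq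
        funext i
        rw [← extTuple_fin a, ← extTuple_fin a']
        have hi := i.2
        rcases Nat.lt_or_ge i.1 r with h | h
        · exact congrFun (e1.trans e2.symm) ⟨i.1, h⟩
        · have : i.1 = r ∨ i.1 = r + 1 ∨ i.1 = r + 2 := by omega
          rcases this with h | h | h <;> rw [h] <;> assumption)
  have hcardt : (Fintype.piFinset (fun i : Fin r => Finset.Icc 1 ((r + 3) * u i))).card = W := by
    rw [Fintype.card_piFinset, hW, Finset.prod_range]
    simp
  rw [hcardt] at hcount
  have hcR : (s.card : ℝ) ≤ (⌊K * (W : ℝ) ^ ((11 : ℝ) / 17)⌋₊ : ℝ) * W := by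
    exact_mod_cast hcount
  have hfl : (⌊K * (W : ℝ) ^ ((11 : ℝ) / 17)⌋₊ : ℝ) ≤ K * (W : ℝ) ^ ((11 : ℝ) / 17) :=
    Nat.floor_le (by positivity)
  calc (s.card : ℝ) ≤ _ := hcR
    _ ≤ (K * (W : ℝ) ^ ((11 : ℝ) / 17)) * W := by gcongr
    _ = K * ((W : ℝ) ^ ((11 : ℝ) / 17) * (W : ℝ) ^ (1 : ℝ)) := by rw [Real.rpow_one]; ring
    _ = _ := by rw [← Real.rpow_add hWR]; norm_num

/-! ### The constant -/

lemma u_root_mono : Monotone (fun n : ℕ => (u n : ℝ) ^ ((1 : ℝ) / 2 ^ n)) := by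
  apply monotone_nat_of_le_succ
  intro n
  have hu : (0 : ℝ) < u n := by exact_mod_cast u_pos n
  have h1 : (u n : ℝ) ^ (2 : ℝ) ≤ u (n + 1) := by
    rw [u]
    push_cast
    rw [Real.rpow_two]
    nlinarith
  calc (u n : ℝ) ^ ((1 : ℝ) / 2 ^ n) = ((u n : ℝ) ^ (2 : ℝ)) ^ ((1 : ℝ) / 2 ^ (n + 1)) := by
        rw [← Real.rpow_mul hu.le]
        congr 1
        rw [pow_succ]
        field_simp
    _ ≤ _ := by gcongr

lemma u_le_pow {c₀ : ℝ} (hc₀ : Filter.Tendsto (fun n : ℕ => (u n : ℝ) ^ ((1 : ℝ) / 2 ^ n))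
      Filter.atTop (nhds c₀)) (n : ℕ) : (u n : ℝ) ≤ c₀ ^ ((2 : ℝ) ^ n) := by
  have hu : (0 : ℝ) < u n := by exact_mod_cast u_pos n
  have h1 : (u n : ℝ) ^ ((1 : ℝ) / 2 ^ n) ≤ c₀ := u_root_mono.ge_of_tendsto hc₀ n
  calc (u n : ℝ) = ((u n : ℝ) ^ ((1 : ℝ) / 2 ^ n)) ^ ((2 : ℝ) ^ n) := by
        rw [← Real.rpow_mul hu.le, one_div_mul_cancel (by positivity), Real.rpow_one]
    _ ≤ _ := by gcongr

lemma one_lt_c {c₀ : ℝ} (hc₀ : Filter.Tendsto (fun n : ℕ => (u n : ℝ) ^ ((1 : ℝ) / 2 ^ n))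
      Filter.atTop (nhds c₀)) : 1 < c₀ := by
  have h1 : (u 1 : ℝ) ^ ((1 : ℝ) / 2 ^ 1) ≤ c₀ := u_root_mono.ge_of_tendsto hc₀ 1
  refine lt_of_lt_of_le ?_ h1
  apply Real.one_lt_rpow
  · simp [u]
  · norm_num

theorem stmt_5 (c₀ : ℝ)
    (hc₀ : Filter.Tendsto (fun n : ℕ => (u n : ℝ) ^ ((1 : ℝ) / 2 ^ n))
      Filter.atTop (nhds c₀)) :
    ∀ ε : ℝ, 0 < ε → ∃ K : ℕ, ∀ k : ℕ, K ≤ k →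
      (numSols k 1 1 : ℝ) < c₀ ^ ((7 / 17 + ε) * 2 ^ (k - 1)) := by
  intro ε hε
  obtain ⟨K, hK, hcount⟩ := count_k
  have hc1 : 1 < c₀ := one_lt_c hc₀
  have hc0 : 0 < c₀ := by linarith
  have hlc : 0 < Real.log c₀ := Real.log_pos hc1
  have hlK : 0 ≤ Real.log K := Real.log_nonneg hK
  have ht := tendsto_pow_const_div_const_pow_of_one_lt 2 (r := (2 : ℝ)) (by norm_num)
  have hη : 0 < ε * Real.log c₀ / 2 / (Real.log K + 2) := by positivity
  obtain ⟨K1, hK1⟩ := Filter.eventually_atTop.mp (ht.eventually (gt_mem_nhds hη))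
  refine ⟨max K1 3, fun k hk => ?_⟩
  have hkK1 : K1 ≤ k := (le_max_left _ _).trans hk
  have hk3 : 3 ≤ k := (le_max_right _ _).trans hk
  obtain ⟨r, rfl⟩ : ∃ r, k = r + 3 := ⟨k - 3, by omega⟩
  have hsmall := hK1 (r + 3) hkK1
  set k : ℕ := r + 3 with hkdef
  have hkR : (3 : ℝ) ≤ (k : ℝ) := by exact_mod_cast hk3
  have hk0 : (0 : ℝ) < k := by linarith
  -- bound for the product
  have hprodu : ∏ i ∈ Finset.range r, (u i : ℝ) ≤ u r := by
    rw [← prod_u]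
    exact Finset.prod_le_prod (fun i _ => by positivity) (fun i _ => by linarith)
  have hW : ((∏ i ∈ Finset.range r, ((r + 3) * u i) : ℕ) : ℝ) ≤
      (k : ℝ) ^ k * c₀ ^ ((2 : ℝ) ^ r) := by
    rw [Finset.prod_mul_distrib, Finset.prod_const, Finset.card_range]
    push_cast
    have h1 : ((r : ℝ) + 3) ^ r ≤ (k : ℝ) ^ k := by
      have : ((r : ℝ) + 3) = k := by rw [hkdef]; push_cast; ring
      rw [this]
      exact pow_le_pow_right₀ (by linarith) (by omega)
    have h2 := hprodu.trans (u_le_pow hc₀ r)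
    gcongr
  have hWpos : 0 ≤ ((∏ i ∈ Finset.range r, ((r + 3) * u i) : ℕ) : ℝ) := by positivity
  have hkey : K * ((k : ℝ) ^ k) ^ ((28 : ℝ) / 17) < c₀ ^ (ε * 2 ^ (k - 1)) := by
    have hpow : (2 : ℝ) ^ k = 2 * 2 ^ (k - 1) := by
      rw [← pow_succ']
      congr 1
    have hlhs : 0 < K * ((k : ℝ) ^ k) ^ ((28 : ℝ) / 17) := by positivity
    rw [← Real.log_lt_log_iff hlhs (by positivity), Real.log_mul (by positivity) (by positivity),
      Real.log_rpow (by positivity), Real.log_rpow hc0, Real.log_pow]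
    have hlk : Real.log k ≤ k := by
      have := Real.log_le_sub_one_of_pos hk0
      linarith
    have hlk0 : 0 ≤ Real.log k := Real.log_nonneg (by linarith)
    have h1 : Real.log K + 28 / 17 * ((k : ℝ) * Real.log k) ≤ (Real.log K + 2) * (k : ℝ) ^ 2 := by
      have a1 : (k : ℝ) * Real.log k ≤ (k : ℝ) ^ 2 := by nlinarith
      have a2 : (1 : ℝ) ≤ (k : ℝ) ^ 2 := by nlinarith
      have a3 : 0 ≤ (k : ℝ) * Real.log k := by positivity
      nlinarith
    have h2 : (Real.log K + 2) * (k : ℝ) ^ 2 < ε * 2 ^ (k - 1) * Real.log c₀ := by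
      have h2k : (0 : ℝ) < 2 ^ k := by positivity
      rw [div_lt_iff₀ h2k, div_mul_eq_mul_div, lt_div_iff₀ (by positivity), hpow] at hsmall
      calc (Real.log K + 2) * (k : ℝ) ^ 2 = (k : ℝ) ^ 2 * (Real.log K + 2) := by ring
        _ < _ := hsmall
        _ = _ := by ring
    linarith
  have hexp : (2 : ℝ) ^ r * (28 / 17) = 7 / 17 * 2 ^ (k - 1) := by
    have : (2 : ℝ) ^ (k - 1) = 2 ^ r * 4 := by
      have : k - 1 = r + 2 := by omega
      rw [this, pow_add]
      norm_num
    rw [this]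
    ring
  calc (numSols k 1 1 : ℝ)
      ≤ K * ((∏ i ∈ Finset.range r, ((r + 3) * u i) : ℕ) : ℝ) ^ ((28 : ℝ) / 17) := hcount r
    _ ≤ K * ((k : ℝ) ^ k * c₀ ^ ((2 : ℝ) ^ r)) ^ ((28 : ℝ) / 17) := by gcongr
    _ = (K * ((k : ℝ) ^ k) ^ ((28 : ℝ) / 17)) * c₀ ^ ((2 : ℝ) ^ r * (28 / 17)) := by
        rw [Real.mul_rpow (by positivity) (by positivity), ← Real.rpow_mul hc0.le]
        ring
    _ < c₀ ^ (ε * 2 ^ (k - 1)) * c₀ ^ ((2 : ℝ) ^ r * (28 / 17)) := by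
        have : 0 < c₀ ^ ((2 : ℝ) ^ r * (28 / 17)) := by positivity
        gcongr
    _ = _ := by
        rw [← Real.rpow_add hc0, hexp]
        congr 1
        ring
end

section
/- For every positive integer m and every ε > 0 there are infinitely many positive integers n such that f₃(m,n) ≥ exp( (log 6 − ε) · (log n)/(log log n) ). -/
open Filter Topology

/-- The set of sorted solutions is finite. -/
lemma sols_finite (n : ℕ) (hn : 0 < n) :
    {a : Fin 3 → ℕ | (∀ i, 0 < a i) ∧ Monotone a ∧
      (1 : ℚ) / n = ∑ i, (1 : ℚ) / a i}.Finite := by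
  refine (Set.finite_Icc (0 : Fin 3 → ℕ) (fun _ => n * (3 * n) * (2 * n * (3 * n)) + 3 * n
    + 2 * n * (3 * n))).subset ?_
  rintro a ⟨hpos, hmono, hsum⟩
  have h0 := hpos 0
  have h1 := hpos 1
  have h2 := hpos 2
  have h01 : a 0 ≤ a 1 := hmono (by decide)
  have h12 : a 1 ≤ a 2 := hmono (by decide)
  rw [Fin.sum_univ_three] at hsum
  generalize ha : a 0 = x at *
  generalize hb : a 1 = y at *
  generalize hc : a 2 = z at *
  have key : x * y * z = n * (y * z + x * z + x * y) := by
    have hn' : (n : ℚ) ≠ 0 := by positivity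
    have hx' : (x : ℚ) ≠ 0 := by positivity
    have hy' : (y : ℚ) ≠ 0 := by positivity
    have hz' : (z : ℚ) ≠ 0 := by positivity
    field_simp at hsum
    have : ((x * y * z : ℕ) : ℚ) = ((n * (y * z + x * z + x * y) : ℕ) : ℚ) := by
      push_cast
      linarith
    exact_mod_cast this
  have hx : x ≤ 3 * n := by
    have h3 : x * (y * z) ≤ (3 * n) * (y * z) := by
      have e1 : x * z ≤ y * z := Nat.mul_le_mul_right _ h01
      have e2 : x * y ≤ y * z := by nlinarith
      have : n * (y * z + x * z + x * y) ≤ n * (y * z + y * z + y * z) :=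
        Nat.mul_le_mul_left _ (by omega)
      nlinarith
    exact Nat.le_of_mul_le_mul_right h3 (by positivity)
  have hxn : n < x := by
    by_contra hcon
    push Not at hcon
    have e1 : x * (y * z) ≤ n * (y * z) := Nat.mul_le_mul_right _ hcon
    have e2 : 0 < n * (x * z) := by positivity
    nlinarith
  have hy : y ≤ 2 * n * x := by
    have e : (x - n) * y * z = n * x * (y + z) := by
      obtain ⟨k, rfl⟩ := Nat.exists_eq_add_of_lt hxn
      have : n + k + 1 - n = k + 1 := by omega
      rw [this]
      nlinarith
    have e3 : y * z ≤ (2 * n * x) * z := by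
      have e4 : 1 * (y * z) ≤ (x - n) * (y * z) := Nat.mul_le_mul_right _ (by omega)
      have e5 : n * x * (y + z) ≤ n * x * (z + z) := Nat.mul_le_mul_left _ (by omega)
      nlinarith
    exact Nat.le_of_mul_le_mul_right e3 h2
  have hz : z ≤ n * x * y := by
    apply Nat.le_of_dvd (by positivity)
    have d1 : z ∣ n * (y + x) * z + n * x * y := by
      refine ⟨x * y, ?_⟩
      nlinarith
    exact (Nat.dvd_add_right (Dvd.intro_left _ rfl)).mp d1
  have hy' : y ≤ 2 * n * (3 * n) := hy.trans (Nat.mul_le_mul_left _ hx)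
  have hz' : z ≤ n * (3 * n) * (2 * n * (3 * n)) :=
    hz.trans (Nat.mul_le_mul (Nat.mul_le_mul_left _ hx) hy')
  refine ⟨fun i => Nat.zero_le _, fun i => ?_⟩
  fin_cases i
  · simp [ha]; omega
  · simp [hb]; omega
  · simp [hc]; omega

/-- The ordered solution attached to a pair of divisors. -/
def trip (n : ℕ) (q : ℕ × ℕ) : Fin 3 → ℕ :=
  ![n + n / q.1, n * (q.1 + 1) + q.2, n * (q.1 + 1) + (n * (q.1 + 1)) ^ 2 / q.2]

lemma trip_spec (n : ℕ) (hn : 0 < n) (q : ℕ × ℕ) (h1 : q.1 ∣ n) (h2 : q.2 ∣ n ^ 2) :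
    (∀ i, 0 < trip n q i) ∧ (1 : ℚ) / n = ∑ i, (1 : ℚ) / trip n q i := by
  obtain ⟨d, e⟩ := q
  simp only at h1 h2
  have hd : 0 < d := Nat.pos_of_dvd_of_pos h1 hn
  have he : 0 < e := Nat.pos_of_dvd_of_pos h2 (by positivity)
  constructor
  · intro i
    fin_cases i <;> simp [trip] <;> omega
  · have h3 : e ∣ (n * (d + 1)) ^ 2 := by
      rw [mul_pow]
      exact h2.mul_right _
    have hnq : (n : ℚ) ≠ 0 := by positivity
    have hdq : (d : ℚ) ≠ 0 := by positivity
    have heq : (e : ℚ) ≠ 0 := by positivity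
    have c1 : ((n / d : ℕ) : ℚ) = n / d := Nat.cast_div h1 hdq
    have c2 : (((n * (d + 1)) ^ 2 / e : ℕ) : ℚ) = (n * (d + 1)) ^ 2 / e := by
      rw [Nat.cast_div h3 heq]; push_cast; ring
    rw [Fin.sum_univ_three]
    simp only [trip, Matrix.cons_val_zero, Matrix.cons_val_one, Matrix.cons_val]
    push_cast only [Nat.cast_add, c1, c2, Nat.cast_mul]
    have p1 : (n : ℚ) * (d + 1) + e ≠ 0 := by positivity
    have p2 : (d : ℚ) + 1 ≠ 0 := by positivity
    have A : (1 : ℚ) / (n + n / d) = d / (n * (d + 1)) := by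
      field_simp
    have B : (1 : ℚ) / (n * (d + 1) + (n * (d + 1)) ^ 2 / e)
        = e / (n * (d + 1) * (n * (d + 1) + e)) := by
      have : (n : ℚ) * (d + 1) + (n * (d + 1)) ^ 2 / e
        = (n * (d + 1) * (n * (d + 1) + e)) / e := by field_simp; ring
      rw [this, one_div_div]
    rw [Nat.cast_one, A, B]
    field_simp
    ring

lemma trip_inj (n : ℕ) (hn : 0 < n) (q r : ℕ × ℕ) (h1 : q.1 ∣ n) (k1 : r.1 ∣ n)
    (h : trip n q = trip n r) : q = r := by
  have e0 := congrFun h 0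
  have e1 := congrFun h 1
  simp only [trip, Matrix.cons_val_zero, Matrix.cons_val_one] at e0 e1
  have e2 : n / q.1 = n / r.1 := by omega
  have e3 : q.1 = r.1 := by
    have := congrArg (fun t => n / t) e2
    simpa only [Nat.div_div_self h1 hn.ne', Nat.div_div_self k1 hn.ne'] using this
  rw [e3] at e1
  exact Prod.ext e3 (by omega)

lemma count_le (m n : ℕ) (hm : 0 < m) (hn : 0 < n) :
    n.divisors.card * (n ^ 2).divisors.card ≤ 6 * numSols 3 m (m * n) := by
  have hq : (m : ℚ) / ((m * n : ℕ) : ℚ) = 1 / n := by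
    have : (m : ℚ) ≠ 0 := by positivity
    push_cast
    field_simp
  unfold numSols
  rw [hq]
  have hfin : Finite {a : Fin 3 → ℕ // (∀ i, 0 < a i) ∧ Monotone a ∧
    (1 : ℚ) / n = ∑ i, (1 : ℚ) / a i} := (sols_finite n hn).to_subtype
  have hperm : Nat.card (Equiv.Perm (Fin 3)) = 6 := by
    rw [Nat.card_perm, Nat.card_eq_fintype_card, Fintype.card_fin]; rfl
  rw [← Finset.card_product, ← Nat.card_eq_finsetCard, ← hperm, ← Nat.card_prod]
  have hspec : ∀ q : (n.divisors ×ˢ (n ^ 2).divisors : Finset (ℕ × ℕ)),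
      q.1.1 ∣ n ∧ q.1.2 ∣ n ^ 2 := by
    rintro ⟨q, hq⟩
    rw [Finset.mem_product] at hq
    exact ⟨Nat.dvd_of_mem_divisors hq.1, Nat.dvd_of_mem_divisors hq.2⟩
  refine Nat.card_le_card_of_injective
    (fun q => (Tuple.sort (trip n q.1), ⟨trip n q.1 ∘ Tuple.sort (trip n q.1),
      fun i => (trip_spec n hn q.1 (hspec q).1 (hspec q).2).1 _,
      Tuple.monotone_sort _, ?_⟩)) ?_
  · rw [(trip_spec n hn q.1 (hspec q).1 (hspec q).2).2]
    exact (Equiv.sum_comp (Tuple.sort (trip n q.1)) (fun i => (1 : ℚ) / trip n q.1 i)).symm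
  · intro q r hqr
    simp only [Prod.mk.injEq, Subtype.mk.injEq] at hqr
    obtain ⟨e1, e2⟩ := hqr
    rw [e1] at e2
    have e3 : trip n q.1 = trip n r.1 := by
      funext i
      have := congrFun e2 ((Tuple.sort (trip n r.1)).symm i)
      simpa using this
    exact Subtype.ext (trip_inj n hn _ _ (hspec q).1 (hspec r).1 e3)

lemma card_div_primorial (x : ℕ) :
    (primorial x).divisors.card * ((primorial x) ^ 2).divisors.card
      = 6 ^ Nat.primeCounting x := by
  have hne := primorial_ne_zero x
  have hf : ∀ p ∈ (primorial x).primeFactors, (primorial x).factorization p = 1 := fun p hp =>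
    Nat.factorization_eq_one_of_squarefree (squarefree_primorial x)
      (Nat.prime_of_mem_primeFactors hp) (Nat.dvd_of_mem_primeFactors hp)
  rw [Nat.card_divisors hne, Nat.card_divisors (pow_ne_zero 2 hne),
    Nat.primeFactors_pow _ two_ne_zero, ← Finset.prod_mul_distrib,
    ← Nat.primesLE_card_eq_primeCounting, ← primeFactors_primorial]
  apply Finset.prod_eq_pow_card
  intro p hp
  simp [hf p hp]

lemma theta_lower : ∃ c : ℝ, 0 < c ∧ ∀ᶠ x : ℕ in atTop, c * x ≤ Chebyshev.theta x := by
  refine ⟨Real.log 2 / 2, by positivity, ?_⟩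
  have h1 : Tendsto (fun x : ℝ => Real.log 2 / x + Real.log x / x
      + 2 * (Real.log x / x ^ (1 / 2 : ℝ))) atTop (𝓝 (0 + 0 + 2 * 0)) :=
    ((tendsto_const_nhds.div_atTop tendsto_id).add
      Real.isLittleO_log_id_atTop.tendsto_div_nhds_zero).add
      ((isLittleO_log_rpow_atTop (by norm_num : (0 : ℝ) < 1 / 2)).tendsto_div_nhds_zero.const_mul 2)
  norm_num only at h1
  have h2 := (h1.comp tendsto_natCast_atTop_atTop).eventually
    (eventually_lt_nhds (by positivity : (0 : ℝ) < Real.log 2 / 2))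
  filter_upwards [h2, eventually_gt_atTop 0] with x hx hx0
  have hx0' : (0 : ℝ) < x := by exact_mod_cast hx0
  have hx1' : (1 : ℝ) ≤ x := by exact_mod_cast hx0
  simp only [Function.comp_apply] at hx
  rw [← Real.sqrt_eq_rpow] at hx
  have hs : 0 < √(x : ℝ) := Real.sqrt_pos.mpr hx0'
  have hss : √(x : ℝ) * √x = x := Real.mul_self_sqrt hx0'.le
  have hmul := mul_lt_mul_of_pos_right hx hx0'
  have e : (Real.log 2 / x + Real.log x / x + 2 * (Real.log x / √x)) * x
      = Real.log 2 + Real.log x + 2 * √x * Real.log x := by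
    have e1 : Real.log x / √x * x = √x * Real.log x := by
      rw [div_mul_eq_mul_div, div_eq_iff hs.ne']
      linear_combination (-Real.log x) * hss
    have e2 : Real.log 2 / x * x = Real.log 2 := div_mul_cancel₀ _ hx0'.ne'
    have e3 : Real.log x / x * x = Real.log x := div_mul_cancel₀ _ hx0'.ne'
    linear_combination e2 + e3 + 2 * e1
  have hl : Real.log ((x : ℝ) + 1) ≤ Real.log 2 + Real.log x := by
    rw [← Real.log_mul (by norm_num) hx0'.ne']
    exact Real.log_le_log (by positivity) (by linarith)
  have := Chebyshev.theta_ge x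
  linarith

lemma asym (δ M C : ℝ) (hδ : 0 < δ) : ∀ᶠ L : ℝ in atTop,
    (1 - δ) * (L / Real.log L) ≤ (L - M) / (Real.log L + C) - 1 := by
  have h1 : Tendsto (fun L : ℝ => (((L - M) / (Real.log L + C) - 1) * (Real.log L / L)))
      atTop (𝓝 1) := by
    have a1 : Tendsto (fun L : ℝ => Real.log L / L) atTop (𝓝 0) :=
      Real.isLittleO_log_id_atTop.tendsto_div_nhds_zero
    have a2 : Tendsto (fun L : ℝ => (L - M) / L) atTop (𝓝 1) := by
      have : Tendsto (fun L : ℝ => 1 - M / L) atTop (𝓝 (1 - 0)) :=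
        tendsto_const_nhds.sub (tendsto_const_nhds.div_atTop tendsto_id)
      rw [sub_zero] at this
      refine this.congr' ?_
      filter_upwards [eventually_gt_atTop 0] with L hL
      field_simp
    have a3 : Tendsto (fun L : ℝ => Real.log L / (Real.log L + C)) atTop (𝓝 1) := by
      have hlc : Tendsto (fun L : ℝ => Real.log L + C) atTop atTop :=
        tendsto_atTop_add_const_right _ _ Real.tendsto_log_atTop
      have : Tendsto (fun L : ℝ => 1 - C / (Real.log L + C)) atTop (𝓝 (1 - 0)) :=
        tendsto_const_nhds.sub (tendsto_const_nhds.div_atTop hlc)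
      rw [sub_zero] at this
      refine this.congr' ?_
      filter_upwards [hlc.eventually (eventually_gt_atTop 0)] with L hL
      rw [eq_div_iff hL.ne', sub_mul, div_mul_cancel₀ _ hL.ne']
      ring
    have := (a2.mul a3).sub a1
    simp only [mul_one, sub_zero] at this
    refine this.congr' ?_
    filter_upwards [eventually_gt_atTop 0] with L hL
    have hLL : L / L = 1 := div_self hL.ne'
    ring
  have h2 := h1.eventually (eventually_gt_nhds (by linarith : 1 - δ < 1))
  filter_upwards [h2, eventually_gt_atTop 1] with L hL hL1
  have hl : 0 < Real.log L := Real.log_pos hL1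
  have hq : 0 < L / Real.log L := by positivity
  have := mul_le_mul_of_nonneg_right hL.le hq.le
  refine this.trans (le_of_eq ?_)
  rw [mul_assoc]
  have : Real.log L / L * (L / Real.log L) = 1 := by field_simp
  rw [this, mul_one]

theorem stmt_7 (m : ℕ) (hm : 0 < m) (ε : ℝ) (hε : 0 < ε) :
    ∀ N : ℕ, ∃ n : ℕ, N ≤ n ∧ 0 < n ∧
      Real.exp ((Real.log 6 - ε) * (Real.log n / Real.log (Real.log n)))
        ≤ (numSols 3 m n : ℝ) := by
  intro N
  obtain ⟨c, hc, hth⟩ := theta_lower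
  have h6 : 0 < Real.log 6 := Real.log_pos (by norm_num)
  have hLt : Tendsto (fun x : ℕ => Real.log ((m * primorial x : ℕ) : ℝ)) atTop atTop := by
    apply Real.tendsto_log_atTop.comp
    apply tendsto_natCast_atTop_atTop.comp
    apply tendsto_atTop_mono _ tendsto_id
    intro x
    exact (le_primorial_self (n := x)).trans (Nat.le_mul_of_pos_left _ hm)
  have hev := hLt.eventually (asym (ε / Real.log 6) (Real.log m) (-Real.log c) (by positivity))
  obtain ⟨x, hx1, hx2, hx3, hx4⟩ := (hth.and (hev.and
    ((eventually_ge_atTop (N + 2)).and (hLt.eventually (eventually_gt_atTop 1))))).exists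
  have hP := primorial_pos x
  refine ⟨m * primorial x, ?_, by positivity, ?_⟩
  · exact (by omega : N ≤ x).trans
      ((le_primorial_self (n := x)).trans (Nat.le_mul_of_pos_left _ hm))
  set L := Real.log ((m * primorial x : ℕ) : ℝ) with hL
  have hxpos : (1 : ℝ) < x := by exact_mod_cast (by omega : 1 < x)
  have hLeq : L = Real.log m + Chebyshev.theta x := by
    rw [hL, Chebyshev.theta_eq_log_primorial, Nat.floor_natCast]
    push_cast
    rw [Real.log_mul (by positivity) (by positivity)]
  have hlogm : 0 ≤ Real.log m := Real.log_natCast_nonneg m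
  have hlx : 0 < Real.log x := Real.log_pos hxpos
  have hlogx : Real.log x ≤ Real.log L + -Real.log c := by
    have : Real.log (c * x) ≤ Real.log L := Real.log_le_log (by positivity) (by linarith)
    rw [Real.log_mul hc.ne' (by positivity)] at this
    linarith
  have hpi : (L - Real.log m) / (Real.log L + -Real.log c) ≤ Nat.primeCounting x := by
    rw [div_le_iff₀ (by linarith)]
    have := Chebyshev.theta_le_pi_mul_log x
    have h2 : (Nat.primeCounting x : ℝ) * Real.log x
      ≤ Nat.primeCounting x * (Real.log L + -Real.log c) := by gcongr
    linarith
  have hcount : (6 : ℝ) ^ Nat.primeCounting x ≤ 6 * (numSols 3 m (m * primorial x) : ℝ) := by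
    have := count_le m (primorial x) hm hP
    rw [card_div_primorial] at this
    exact_mod_cast this
  have hexp : (Real.log 6 - ε) * (L / Real.log L)
      ≤ Real.log 6 * Nat.primeCounting x - Real.log 6 := by
    have e1 : (1 - ε / Real.log 6) * (L / Real.log L) ≤ Nat.primeCounting x - 1 := by linarith
    have e2 := mul_le_mul_of_nonneg_left e1 h6.le
    have e3 : Real.log 6 * ((1 - ε / Real.log 6) * (L / Real.log L))
      = (Real.log 6 - ε) * (L / Real.log L) := by field_simp
    linarith
  calc Real.exp ((Real.log 6 - ε) * (L / Real.log L))
      ≤ Real.exp (Real.log 6 * Nat.primeCounting x - Real.log 6) := Real.exp_le_exp.mpr hexp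
    _ = 6 ^ Nat.primeCounting x / 6 := by
      rw [Real.exp_sub, mul_comm, Real.exp_nat_mul, Real.exp_log (by norm_num)]
    _ ≤ _ := by linarith
end
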